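/- arXiv:2511.06553 — 2 statements merged into one kernel-verified Lean document; each statement's English description precedes it below -/
import Mathlib

section
/- Let p ≥ 1, T > 0, and let u : ℝ × (0,T) → ℝ be a smooth, strictly positive solution of the fourth-order equation ∂_t u = −∂_x²( u^p ∂_x²(ln_p u) ) such that for every t ∈ (0,T) the function u(·,t) is a probability density which, together with all its spatial derivatives, decays faster than any polynomial as |x| → ∞, has finite positive second moment Θ(t) = ∫_ℝ x² u(x,t) dx, and has generalized Fisher information I_p(u(·,t)) > 0. Let Θ₀ = lim_{t↓0} Θ(t) > 0, define τ(t) = (Θ₀/(4p)) ln(Θ(t)/Θ₀), and assume τ is a C¹ strictly increasing bijection of (0,T) onto an interval (0,T′) with inverse t(·). Define v(y,τ) = s(τ) u(s(τ) y, t(τ)) where s(τ) = (Θ(t(τ))/Θ₀)^{1/2}. Then v satisfies the nonlocal fourth-order equation ∂_τ v(y,τ) = −(1/I_p(v(·,τ))) ∂_y²( v^p ∂_y²(ln_p v) )(y,τ) + (2p/Θ₀) ∂_y( y v(y,τ) ) for all (y,τ) with τ ∈ (0,T′). -/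
open MeasureTheory Filter Set

/-- The `p`-logarithm: `ln_p u = (u^(p-1) - 1)/(p-1)` for `p ≠ 1`, and `ln u` for `p = 1`. -/
noncomputable def lnp (p : ℝ) (u : ℝ) : ℝ :=
  if p = 1 then Real.log u else (u ^ (p - 1) - 1) / (p - 1)

/-- Generalized Fisher information `I_p(f) = (1/2) ∫ f ((ln_p f)')²`. -/
noncomputable def fisherP (p : ℝ) (f : ℝ → ℝ) : ℝ :=
  (1 / 2) * ∫ x : ℝ, f x * (deriv (fun y => lnp p (f y)) x) ^ 2

/-- Rényi entropy of order `p ≠ 1`: `R_p(f) = (1/(1-p)) ln ∫ f^p`. -/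
noncomputable def renyi (p : ℝ) (f : ℝ → ℝ) : ℝ :=
  (1 / (1 - p)) * Real.log (∫ x : ℝ, f x ^ p)

/-- `f`, together with all its derivatives, decays faster than any polynomial at infinity. -/
def RapidDecay (f : ℝ → ℝ) : Prop :=
  ∀ n k : ℕ, Tendsto (fun x => x ^ n * iteratedDeriv k f x) (cocompact ℝ) (nhds 0)

/-- A function vanishing outside a bounded interval and its derivative integrate to the same value
when they differ by an exact derivative of a function with the same property. -/
theorem integral_eq_of_hasDerivAt_sub {c : ℝ} {F f g : ℝ → ℝ}
    (hF : ∀ x, HasDerivAt F (f x - g x) x) (hf : Continuous f) (hg : Continuous g)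
    (hF0 : ∀ x, x ∉ Icc (-c) c → F x = 0) (hf0 : ∀ x, x ∉ Icc (-c) c → f x = 0)
    (hg0 : ∀ x, x ∉ Icc (-c) c → g x = 0) : ∫ x, f x = ∫ x, g x := by
  have hfi : Integrable f := hf.integrable_of_hasCompactSupport (.intro isCompact_Icc hf0)
  have hgi : Integrable g := hg.integrable_of_hasCompactSupport (.intro isCompact_Icc hg0)
  have hFc : Continuous F := continuous_iff_continuousAt.2 fun x => (hF x).continuousAt
  have hFi : Integrable F := hFc.integrable_of_hasCompactSupport (.intro isCompact_Icc hF0)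
  have := integral_eq_zero_of_hasDerivAt_of_integrable hF (hfi.sub hgi) hFi
  rw [integral_sub hfi hgi] at this
  linarith

/-- The derivative relations between a positive density `u` at a fixed time and the auxiliary
functions `r = u ^ (p - 1)`, `l = ln_p u`, `L = l'`, `a = l''`, `b = l'''` and
`K = (u ^ p l'')''`. -/
structure IsProfile (p : ℝ) (u r l L a b K : ℝ → ℝ) : Prop where
  one_le : 1 ≤ p
  pos : ∀ x, 0 < u x
  pos_r : ∀ x, 0 < r x
  hasDerivAt_u : ∀ x, HasDerivAt u (u x * L x / r x) x
  hasDerivAt_r : ∀ x, HasDerivAt r ((p - 1) * L x) x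
  hasDerivAt_l : ∀ x, HasDerivAt l (L x) x
  hasDerivAt_L : ∀ x, HasDerivAt L (a x) x
  hasDerivAt_a : ∀ x, HasDerivAt a (b x) x
  hasDerivAt_flux : ∀ x, HasDerivAt (fun x => u x * (p * L x * a x + r x * b x)) (K x) x
  continuous_b : Continuous b
  continuous_K : Continuous K

/-- A twice differentiable cutoff with values in `[0, 1]`, supported in `[-c, c]`. -/
structure IsCutoff (c : ℝ) (χ χ₁ χ₂ : ℝ → ℝ) : Prop where
  nonneg : ∀ x, 0 ≤ χ x
  le_one : ∀ x, χ x ≤ 1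
  hasDerivAt : ∀ x, HasDerivAt χ (χ₁ x) x
  hasDerivAt' : ∀ x, HasDerivAt χ₁ (χ₂ x) x
  continuous₂ : Continuous χ₂
  zero : ∀ x, x ∉ Icc (-c) c → χ x = 0
  zero₁ : ∀ x, x ∉ Icc (-c) c → χ₁ x = 0
  zero₂ : ∀ x, x ∉ Icc (-c) c → χ₂ x = 0

theorem continuous_of_hasDerivAt {f f' : ℝ → ℝ} (h : ∀ x, HasDerivAt f (f' x) x) : Continuous f :=
  continuous_iff_continuousAt.2 fun x => (h x).continuousAt

theorem IsCutoff.continuous {c : ℝ} {χ χ₁ χ₂ : ℝ → ℝ} (h : IsCutoff c χ χ₁ χ₂) : Continuous χ :=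
  continuous_of_hasDerivAt h.hasDerivAt

theorem IsCutoff.continuous₁ {c : ℝ} {χ χ₁ χ₂ : ℝ → ℝ} (h : IsCutoff c χ χ₁ χ₂) : Continuous χ₁ :=
  continuous_of_hasDerivAt h.hasDerivAt'

namespace IsProfile

variable {p : ℝ} {u r l L a b K : ℝ → ℝ}

theorem continuous_u (h : IsProfile p u r l L a b K) : Continuous u :=
  continuous_of_hasDerivAt h.hasDerivAt_u

theorem continuous_r (h : IsProfile p u r l L a b K) : Continuous r :=
  continuous_of_hasDerivAt h.hasDerivAt_r

theorem continuous_l (h : IsProfile p u r l L a b K) : Continuous l :=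
  continuous_of_hasDerivAt h.hasDerivAt_l

theorem continuous_L (h : IsProfile p u r l L a b K) : Continuous L :=
  continuous_of_hasDerivAt h.hasDerivAt_L

theorem continuous_a (h : IsProfile p u r l L a b K) : Continuous a :=
  continuous_of_hasDerivAt h.hasDerivAt_a

theorem integral_test_eq (h : IsProfile p u r l L a b K) {c : ℝ} {f f₁ f₂ f₃ f₄ : ℝ → ℝ}
    (hf : ∀ x, HasDerivAt f (f₁ x) x) (hf₁ : ∀ x, HasDerivAt f₁ (f₂ x) x)
    (hf₂ : ∀ x, HasDerivAt f₂ (f₃ x) x) (hf₃ : ∀ x, HasDerivAt f₃ (f₄ x) x)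
    (hf₄ : Continuous f₄) (z : ∀ x, x ∉ Icc (-c) c → f x = 0)
    (z₁ : ∀ x, x ∉ Icc (-c) c → f₁ x = 0) (z₂ : ∀ x, x ∉ Icc (-c) c → f₂ x = 0)
    (z₃ : ∀ x, x ∉ Icc (-c) c → f₃ x = 0) (z₄ : ∀ x, x ∉ Icc (-c) c → f₄ x = 0) :
    ∫ x, f x * (-K x) =
      ∫ x, (p * (f₂ x * (u x * L x ^ 2)) - f₄ x * (r x ^ 2 * u x) / (2 * p - 1)) := by
  have cu := h.continuous_u
  have cr := h.continuous_r
  have cL := h.continuous_L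
  have cK := h.continuous_K
  have cf := continuous_of_hasDerivAt hf
  have cf₂ := continuous_of_hasDerivAt hf₂
  refine integral_eq_of_hasDerivAt_sub (c := c)
    (F := fun x => -(f x * (u x * (p * L x * a x + r x * b x)) - f₁ x * (r x * u x * a x))
      - f₂ x * (r x * u x * L x) + f₃ x * (r x ^ 2 * u x) / (2 * p - 1))
    (fun x => ?_) (by fun_prop) (by fun_prop) (fun x hx => ?_) (fun x hx => ?_) (fun x hx => ?_)
  · have hu := h.hasDerivAt_u x
    have hr := h.hasDerivAt_r x
    have hL := h.hasDerivAt_L x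
    have ha := h.hasDerivAt_a x
    have hp : 2 * p - 1 ≠ 0 := by linarith [h.one_le]
    have r0 := (h.pos_r x).ne'
    obtain ⟨q, hq⟩ : ∃ q, q = 2 * p - 1 := ⟨_, rfl⟩
    rw [← hq] at hp ⊢
    obtain rfl : p = (q + 1) / 2 := by linarith
    refine HasDerivAt.congr_deriv ((((((hf x).mul (h.hasDerivAt_flux x)).sub
      ((hf₁ x).mul ((hr.mul hu).mul ha))).neg).sub
      ((hf₂ x).mul ((hr.mul hu).mul hL))).add
      (((hf₃ x).mul ((hr.pow 2).mul hu)).div_const q)) ?_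
    simp only [Pi.mul_apply, Pi.pow_apply]
    field_simp
    ring
  all_goals simp [z x hx, z₁ x hx, z₂ x hx, z₃ x hx, z₄ x hx]

theorem integral_entropy_le (h : IsProfile p u r l L a b K) {c : ℝ} {χ χ₁ χ₂ : ℝ → ℝ}
    (hχ : IsCutoff c χ χ₁ χ₂) :
    ∫ x, χ x ^ 4 * (l x * (-K x)) ≤
      ∫ x, (-(1 / 2) * (χ x ^ 4 * (r x * u x * a x ^ 2)) +
        64 * (χ x ^ 2 * χ₁ x ^ 2 * (r x * u x * L x ^ 2)) +
        (12 * χ₁ x ^ 2 + 4 * χ x * χ₂ x) ^ 2 * (r x * u x * l x ^ 2)) := by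
  have cu := h.continuous_u
  have cr := h.continuous_r
  have cl := h.continuous_l
  have cL := h.continuous_L
  have ca := h.continuous_a
  have cK := h.continuous_K
  have cχ := hχ.continuous
  have cχ₁ := hχ.continuous₁
  have cχ₂ := hχ.continuous₂
  have key : ∫ x, χ x ^ 4 * (l x * (-K x)) =
      ∫ x, -((χ x ^ 4 * a x + 8 * χ x ^ 3 * χ₁ x * L x +
        (12 * χ x ^ 2 * χ₁ x ^ 2 + 4 * χ x ^ 3 * χ₂ x) * l x) * (r x * u x * a x)) := by
    refine integral_eq_of_hasDerivAt_sub (c := c)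
      (F := fun x => -(χ x ^ 4 * l x * (u x * (p * L x * a x + r x * b x)))
        + (4 * χ x ^ 3 * χ₁ x * l x + χ x ^ 4 * L x) * (r x * u x * a x))
      (fun x => ?_) (by fun_prop) (by fun_prop) (fun x hx => ?_) (fun x hx => ?_) (fun x hx => ?_)
    · have hu := h.hasDerivAt_u x
      have hr := h.hasDerivAt_r x
      have hl := h.hasDerivAt_l x
      have hL := h.hasDerivAt_L x
      have ha := h.hasDerivAt_a x
      have r0 := (h.pos_r x).ne'
      have h1 := hχ.hasDerivAt x
      have h2 := hχ.hasDerivAt' x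
      refine HasDerivAt.congr_deriv (((((h1.pow 4).mul hl).mul (h.hasDerivAt_flux x)).neg).add
        ((((((h1.pow 3).const_mul 4).mul h2).mul hl).add ((h1.pow 4).mul hL)).mul
          ((hr.mul hu).mul ha))) ?_
      simp only [Pi.mul_apply, Pi.pow_apply, Pi.add_apply]
      field_simp
      ring
    all_goals simp [hχ.zero x hx]
  rw [key]
  refine integral_mono
    (Continuous.integrable_of_hasCompactSupport (by fun_prop)
      (.intro (isCompact_Icc (a := -c) (b := c)) fun x hx => by simp [hχ.zero x hx]))
    (Continuous.integrable_of_hasCompactSupport (by fun_prop)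
      (.intro (isCompact_Icc (a := -c) (b := c)) fun x hx => by
        simp [hχ.zero x hx, hχ.zero₁ x hx]))
    fun x => ?_
  · have hru : 0 ≤ r x * u x := (mul_pos (h.pos_r x) (h.pos x)).le
    have := mul_nonneg hru (add_nonneg (sq_nonneg (χ x ^ 2 * a x / 2 + 8 * χ x * χ₁ x * L x))
      (sq_nonneg (χ x ^ 2 * a x / 2 + (12 * χ₁ x ^ 2 + 4 * χ x * χ₂ x) * l x)))
    simp only
    nlinarith

theorem integral_quartic_le (h : IsProfile p u r l L a b K) {c : ℝ} {χ χ₁ χ₂ : ℝ → ℝ}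
    (hχ : IsCutoff c χ χ₁ χ₂) :
    ∫ x, χ x ^ 4 * (u x * L x ^ 4) ≤
      ∫ x, (32 * (χ x ^ 2 * χ₁ x ^ 2 * (r x ^ 2 * u x * L x ^ 2)) +
        18 * (χ x ^ 4 * (r x ^ 2 * u x * a x ^ 2))) := by
  have cu := h.continuous_u
  have cr := h.continuous_r
  have cL := h.continuous_L
  have ca := h.continuous_a
  have cχ := hχ.continuous
  have cχ₁ := hχ.continuous₁
  have key : ∫ x, 2 * p * (χ x ^ 4 * (u x * L x ^ 4)) =
      ∫ x, -(8 * χ x ^ 3 * χ₁ x * (r x * u x * L x ^ 3)) -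
        6 * (χ x ^ 4 * (r x * u x * L x ^ 2 * a x)) := by
    refine integral_eq_of_hasDerivAt_sub (c := c)
      (F := fun x => 2 * (χ x ^ 4 * (r x * u x * L x ^ 3)))
      (fun x => ?_) (by fun_prop) (by fun_prop) (fun x hx => ?_) (fun x hx => ?_) (fun x hx => ?_)
    · have hu := h.hasDerivAt_u x
      have hr := h.hasDerivAt_r x
      have hL := h.hasDerivAt_L x
      have r0 := (h.pos_r x).ne'
      have h1 := hχ.hasDerivAt x
      refine HasDerivAt.congr_deriv (((h1.pow 4).mul ((hr.mul hu).mul (hL.pow 3))).const_mul 2) ?_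
      simp only [Pi.mul_apply, Pi.pow_apply]
      field_simp
      ring
    all_goals simp [hχ.zero x hx]
  have i1 : Integrable fun x => χ x ^ 4 * (u x * L x ^ 4) :=
    Continuous.integrable_of_hasCompactSupport (by fun_prop)
      (.intro (isCompact_Icc (a := -c) (b := c)) fun x hx => by simp [hχ.zero x hx])
  have i2 : Integrable fun x => -(8 * χ x ^ 3 * χ₁ x * (r x * u x * L x ^ 3)) -
        6 * (χ x ^ 4 * (r x * u x * L x ^ 2 * a x)) :=
    Continuous.integrable_of_hasCompactSupport (by fun_prop)
      (.intro (isCompact_Icc (a := -c) (b := c)) fun x hx => by simp [hχ.zero x hx])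
  have i3 : Integrable fun x => 32 * (χ x ^ 2 * χ₁ x ^ 2 * (r x ^ 2 * u x * L x ^ 2)) +
        18 * (χ x ^ 4 * (r x ^ 2 * u x * a x ^ 2)) :=
    Continuous.integrable_of_hasCompactSupport (by fun_prop)
      (.intro (isCompact_Icc (a := -c) (b := c)) fun x hx => by simp [hχ.zero x hx])
  have i4 : Integrable fun x => 2 * p * (χ x ^ 4 * (u x * L x ^ 4)) -
      (-(8 * χ x ^ 3 * χ₁ x * (r x * u x * L x ^ 3)) -
        6 * (χ x ^ 4 * (r x * u x * L x ^ 2 * a x))) := (i1.const_mul _).sub i2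
  have hle : ∫ x, (2 * p * (χ x ^ 4 * (u x * L x ^ 4)) -
      (-(8 * χ x ^ 3 * χ₁ x * (r x * u x * L x ^ 3)) -
        6 * (χ x ^ 4 * (r x * u x * L x ^ 2 * a x)))) = 0 := by
    rw [integral_sub (i1.const_mul _) i2, key, sub_self]
  rw [← add_zero (∫ x, (32 * _ + _)), ← hle, ← integral_add i3 i4]
  refine integral_mono i1 (i3.add i4) fun x => ?_
  have h1 := mul_nonneg (h.pos x).le (add_nonneg
    (sq_nonneg (χ x ^ 2 * L x ^ 2 + 8 * χ x * χ₁ x * r x * L x))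
    (sq_nonneg (χ x ^ 2 * (L x ^ 2 + 6 * r x * a x))))
  have h2 := mul_nonneg (sub_nonneg.2 h.one_le)
    (mul_nonneg (pow_nonneg (hχ.nonneg x) 4)
      (mul_nonneg (h.pos x).le (by positivity : 0 ≤ L x ^ 4)))
  simp only
  linarith

theorem integral_fisher_le (h : IsProfile p u r l L a b K) {c : ℝ} {χ χ₁ χ₂ : ℝ → ℝ}
    (hχ : IsCutoff c χ χ₁ χ₂) {M : ℝ → ℝ}
    (hM : ∀ x, HasDerivAt (fun x => r x / u x * (-K x)) (M x) x) (cM : Continuous M) :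
    ∫ x, χ x ^ 6 * (1 / 2 * (-K x) * L x ^ 2 + u x * L x * M x) ≤
      ∫ x, (144 * (χ x ^ 4 * χ₁ x ^ 2 * (r x ^ 2 * u x * a x ^ 2)) +
        36 * (p - 1 / 2) ^ 2 * (χ x ^ 4 * χ₁ x ^ 2 * (u x * L x ^ 4)) +
        (30 * χ x * χ₁ x ^ 2 + 6 * χ x ^ 2 * χ₂ x) ^ 2 * (r x ^ 2 * u x * L x ^ 2)) := by
  have cu := h.continuous_u
  have cr := h.continuous_r
  have cL := h.continuous_L
  have ca := h.continuous_a
  have cb := h.continuous_b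
  have cK := h.continuous_K
  have cχ := hχ.continuous
  have cχ₁ := hχ.continuous₁
  have cχ₂ := hχ.continuous₂
  have key : ∫ x, χ x ^ 6 * (1 / 2 * (-K x) * L x ^ 2 + u x * L x * M x) =
      ∫ x, u x * (p * L x * a x + r x * b x) * (-(χ x ^ 6 * (p * L x * a x + r x * b x))
        - 6 * χ x ^ 5 * χ₁ x * (2 * r x * a x + (p - 1 / 2) * L x ^ 2)
        - (30 * χ x ^ 4 * χ₁ x ^ 2 + 6 * χ x ^ 5 * χ₂ x) * (r x * L x)) := by
    refine integral_eq_of_hasDerivAt_sub (c := c)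
      (F := fun x => χ x ^ 6 * (u x * L x) * (r x / u x * (-K x)) -
        (χ x ^ 6 * (-(r x * a x) - 1 / 2 * L x ^ 2) - 6 * χ x ^ 5 * χ₁ x * (r x * L x)) *
          (u x * (p * L x * a x + r x * b x)))
      (fun x => ?_) (by fun_prop) (by fun_prop) (fun x hx => ?_) (fun x hx => ?_) (fun x hx => ?_)
    · have hu := h.hasDerivAt_u x
      have hr := h.hasDerivAt_r x
      have hL := h.hasDerivAt_L x
      have ha := h.hasDerivAt_a x
      have r0 := (h.pos_r x).ne'
      have u0 := (h.pos x).ne'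
      have h1 := hχ.hasDerivAt x
      have h2 := hχ.hasDerivAt' x
      refine HasDerivAt.congr_deriv ((((h1.pow 6).mul (hu.mul hL)).mul (hM x)).sub
        ((((h1.pow 6).mul (((hr.mul ha).neg).sub ((hL.pow 2).const_mul (1 / 2)))).sub
          ((((h1.pow 5).const_mul 6).mul h2).mul (hr.mul hL))).mul (h.hasDerivAt_flux x))) ?_
      simp only [Pi.mul_apply, Pi.pow_apply, Pi.neg_apply, Pi.sub_apply]
      field_simp
      ring
    all_goals simp [hχ.zero x hx]
  rw [key]
  refine integral_mono
    (Continuous.integrable_of_hasCompactSupport (by fun_prop)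
      (.intro (isCompact_Icc (a := -c) (b := c)) fun x hx => by simp [hχ.zero x hx]))
    (Continuous.integrable_of_hasCompactSupport (by fun_prop)
      (.intro (isCompact_Icc (a := -c) (b := c)) fun x hx => by simp [hχ.zero x hx]))
    fun x => ?_
  have := mul_nonneg (h.pos x).le (add_nonneg (add_nonneg
    (sq_nonneg ((p * L x * a x + r x * b x) * χ x ^ 3 / 2 + 12 * χ x ^ 2 * χ₁ x * (r x * a x)))
    (sq_nonneg ((p * L x * a x + r x * b x) * χ x ^ 3 / 2 +
      6 * (p - 1 / 2) * χ x ^ 2 * χ₁ x * L x ^ 2)))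
    (add_nonneg (sq_nonneg ((p * L x * a x + r x * b x) * χ x ^ 3 / 2 +
      (30 * χ x * χ₁ x ^ 2 + 6 * χ x ^ 2 * χ₂ x) * (r x * L x)))
      (sq_nonneg ((p * L x * a x + r x * b x) * χ x ^ 3 / 2))))
  simp only
  linarith

theorem mul_le_of_fisher_le (h : IsProfile p u r l L a b K) (hu : Integrable u)
    (hu1 : ∫ x, u x = 1) (hi : Integrable fun x => u x * L x ^ 2) {N : ℝ}
    (hN : ∫ x, u x * L x ^ 2 ≤ N) (h0 : Tendsto (fun x => r x * u x) atBot (nhds 0)) (x : ℝ) :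
    r x * u x ≤ p / 2 * (1 + N) := by
  have hd : ∀ y, HasDerivAt (fun x => r x * u x) (p * u y * L y) y := fun y => by
    have r0 := (h.pos_r y).ne'
    refine HasDerivAt.congr_deriv ((h.hasDerivAt_r y).mul (h.hasDerivAt_u y)) ?_
    field_simp
    ring
  have hp := h.one_le
  have cu := h.continuous_u
  have cL := h.continuous_L
  have ib : Integrable fun y => p / 2 * (u y + u y * L y ^ 2) := (hu.add hi).const_mul _
  have hb : ∀ y, |p * u y * L y| ≤ p / 2 * (u y + u y * L y ^ 2) := fun y => by
    have hpu : 0 ≤ p * u y := mul_nonneg (by linarith) (h.pos y).le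
    rw [abs_mul, abs_of_nonneg hpu]
    nlinarith [mul_nonneg hpu (sq_nonneg (|L y| - 1)), sq_abs (L y)]
  have hpi : Integrable fun y => p * u y * L y :=
    ib.mono' (by fun_prop) (.of_forall hb)
  have := integral_Iic_of_hasDerivAt_of_tendsto (a := x) (hd x).continuousAt.continuousWithinAt
    (fun y _ => hd y) hpi.integrableOn h0
  calc r x * u x = ∫ y in Iic x, p * u y * L y := by rw [this, sub_zero]
    _ ≤ ∫ y in Iic x, p / 2 * (u y + u y * L y ^ 2) :=
      setIntegral_mono hpi.integrableOn ib.integrableOn fun y => (le_abs_self _).trans (hb y)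
    _ ≤ ∫ y, p / 2 * (u y + u y * L y ^ 2) :=
      setIntegral_le_integral ib (.of_forall fun y => (abs_nonneg _).trans (hb y))
    _ ≤ p / 2 * (1 + N) := by
      rw [integral_const_mul, integral_add hu hi, hu1]
      gcongr

theorem dissipation_le (h : IsProfile p u r l L a b K) {R B M N C : ℝ} {χ χ₁ χ₂ : ℝ → ℝ}
    (hR : 1 ≤ R) (hχ : IsCutoff (2 * R) χ χ₁ χ₂) (hB : ∀ x, |χ₁ x| ≤ B / R)
    (hB' : ∀ x, |χ₂ x| ≤ B / R ^ 2) (hB1 : 1 ≤ B) (hM : ∀ x, r x ≤ M)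
    (hi : Integrable fun x => u x * L x ^ 2)
    (hN : ∫ x, u x * L x ^ 2 ≤ N) (hC : ∀ x, r x * u x * l x ^ 2 ≤ C) {k : ℝ → ℝ}
    (hk : ∀ x, HasDerivAt (fun x => r x / u x * (-K x)) (k x) x) (ck : Continuous k) :
    (∫ x, χ x ^ 6 * (1 / 2 * (-K x) * L x ^ 2 + u x * L x * k x)) +
      (288 + 1296 * (p - 1 / 2) ^ 2) * B ^ 2 * M / R ^ 2 * ∫ x, χ x ^ 4 * (l x * (-K x)) ≤
    (1152 * (p - 1 / 2) ^ 2 * B ^ 4 * M ^ 2 * N + 1296 * B ^ 4 * M ^ 2 * N +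
      (288 + 1296 * (p - 1 / 2) ^ 2) * B ^ 2 * M * (64 * B ^ 2 * M * N + 1024 * B ^ 4 * C))
      / R ^ 2 := by
  have cu := h.continuous_u
  have cr := h.continuous_r
  have cl := h.continuous_l
  have cL := h.continuous_L
  have ca := h.continuous_a
  have cχ := hχ.continuous
  have cχ₁ := hχ.continuous₁
  have cχ₂ := hχ.continuous₂
  have R0 : 0 < R := by linarith
  have M0 : 0 < M := (h.pos_r 0).trans_le (hM 0)
  have sq₁ : ∀ x, χ₁ x ^ 2 ≤ B ^ 2 / R ^ 2 := fun x => by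
    rw [← sq_abs, ← div_pow]; gcongr; exact hB x
  have iJ : Integrable fun x => χ x ^ 4 * (r x * u x * a x ^ 2) :=
    Continuous.integrable_of_hasCompactSupport (by fun_prop)
      (.intro (isCompact_Icc (a := -(2 * R)) (b := 2 * R)) fun x hx => by simp [hχ.zero x hx])
  have iY : Integrable fun x => χ x ^ 4 * (u x * L x ^ 4) :=
    Continuous.integrable_of_hasCompactSupport (by fun_prop)
      (.intro (isCompact_Icc (a := -(2 * R)) (b := 2 * R)) fun x hx => by simp [hχ.zero x hx])
  have ic : Integrable ((Icc (-(2 * R)) (2 * R)).indicator fun _ : ℝ => (1 : ℝ)) :=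
    (integrable_indicator_iff measurableSet_Icc).2 (by simp)
  have hic : ∫ x, (Icc (-(2 * R)) (2 * R)).indicator (fun _ : ℝ => (1 : ℝ)) x = 4 * R := by
    rw [integral_indicator measurableSet_Icc]
    simp only [integral_const, MeasurableSet.univ, measureReal_restrict_apply, univ_inter,
      Real.volume_real_Icc, smul_eq_mul, mul_one]
    rw [max_eq_left] <;> linarith
  have hR2 : B ^ 2 / R ^ 2 ≤ B ^ 2 := div_le_self (by positivity) (one_le_pow₀ hR)
  have hχ4 : ∀ x, χ x ^ 2 * χ₁ x ^ 2 ≤ B ^ 2 / R ^ 2 := fun x =>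
    (mul_le_of_le_one_left (sq_nonneg _) (pow_le_one₀ (hχ.nonneg x) (hχ.le_one x))).trans (sq₁ x)
  have hχ6 : ∀ x, χ x ^ 4 * χ₁ x ^ 2 ≤ χ x ^ 4 * (B ^ 2 / R ^ 2) := fun x =>
    mul_le_mul_of_nonneg_left (sq₁ x) (by positivity)
  have hB2 : ∀ x, |χ₂ x| ≤ B ^ 2 / R ^ 2 := fun x => (hB' x).trans (by gcongr; nlinarith)
  have hχ₂ : ∀ x, |χ x * χ₂ x| ≤ B ^ 2 / R ^ 2 := fun x => by
    rw [abs_mul, abs_of_nonneg (hχ.nonneg x)]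
    exact (mul_le_of_le_one_left (abs_nonneg _) (hχ.le_one x)).trans (hB2 x)
  have hC0 : 0 ≤ C :=
    (mul_nonneg (mul_pos (h.pos_r 0) (h.pos 0)).le (sq_nonneg _)).trans (hC 0)
  have hu2 : ∀ x, 0 ≤ u x * L x ^ 2 := fun x => mul_nonneg (h.pos x).le (sq_nonneg _)
  have hN0 : 0 ≤ N := (integral_nonneg hu2).trans hN
  have hru : ∀ x, r x * u x * L x ^ 2 ≤ M * (u x * L x ^ 2) := fun x => by
    rw [mul_assoc]; exact mul_le_mul_of_nonneg_right (hM x) (hu2 x)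
  have hru0 : ∀ x, 0 ≤ r x * u x * L x ^ 2 := fun x =>
    mul_nonneg (mul_pos (h.pos_r x) (h.pos x)).le (sq_nonneg _)
  have hr2u0 : ∀ x, 0 ≤ r x ^ 2 * u x * L x ^ 2 := fun x =>
    mul_nonneg (mul_pos (pow_pos (h.pos_r x) 2) (h.pos x)).le (sq_nonneg _)
  have hr2u : ∀ x, ∀ q : ℝ, 0 ≤ u x * q → r x ^ 2 * u x * q ≤ M ^ 2 * (u x * q) := fun x q hq => by
    rw [mul_assoc]
    exact mul_le_mul_of_nonneg_right (pow_le_pow_left₀ (h.pos_r x).le (hM x) 2) hq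
  have hE : ∫ x, χ x ^ 4 * (l x * (-K x)) ≤
      -(1 / 2) * (∫ x, χ x ^ 4 * (r x * u x * a x ^ 2)) +
        (64 * B ^ 2 * M * N + 1024 * B ^ 4 * C) := by
    have iS : Integrable fun x => 64 * B ^ 2 * M * (u x * L x ^ 2) +
          256 * B ^ 4 * C / R ^ 4 * (Icc (-(2 * R)) (2 * R)).indicator (fun _ : ℝ => (1 : ℝ)) x :=
      (hi.const_mul _).add (ic.const_mul _)
    have iR : Integrable fun x => -(1 / 2) * (χ x ^ 4 * (r x * u x * a x ^ 2)) +
        (64 * B ^ 2 * M * (u x * L x ^ 2) +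
          256 * B ^ 4 * C / R ^ 4 * (Icc (-(2 * R)) (2 * R)).indicator (fun _ : ℝ => (1 : ℝ)) x) :=
      (iJ.const_mul _).add iS
    refine (h.integral_entropy_le hχ).trans ((integral_mono
      (Continuous.integrable_of_hasCompactSupport (by fun_prop)
        (.intro (isCompact_Icc (a := -(2 * R)) (b := 2 * R)) fun x hx => by
          simp [hχ.zero x hx, hχ.zero₁ x hx])) iR fun x => ?_).trans ?_)
    · have h1 : χ x ^ 2 * χ₁ x ^ 2 * (r x * u x * L x ^ 2) ≤ B ^ 2 * (M * (u x * L x ^ 2)) :=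
        mul_le_mul ((hχ4 x).trans hR2) (hru x) (hru0 x) (by positivity)
      have h2 : (12 * χ₁ x ^ 2 + 4 * χ x * χ₂ x) ^ 2 * (r x * u x * l x ^ 2) ≤
          256 * B ^ 4 * C / R ^ 4 *
            (Icc (-(2 * R)) (2 * R)).indicator (fun _ : ℝ => (1 : ℝ)) x := by
        by_cases hx : x ∈ Icc (-(2 * R)) (2 * R)
        · rw [indicator_of_mem hx]
          have : |12 * χ₁ x ^ 2 + 4 * χ x * χ₂ x| ≤ 16 * (B ^ 2 / R ^ 2) := by
            have := abs_le.1 (hχ₂ x)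
            have := sq₁ x
            have := sq_nonneg (χ₁ x)
            rw [abs_le]; constructor <;> linarith
          calc _ = |12 * χ₁ x ^ 2 + 4 * χ x * χ₂ x| ^ 2 * (r x * u x * l x ^ 2) := by rw [sq_abs]
            _ ≤ (16 * (B ^ 2 / R ^ 2)) ^ 2 * C := by
              gcongr
              · exact mul_nonneg (mul_pos (h.pos_r x) (h.pos x)).le (sq_nonneg _)
              · exact hC x
            _ = _ := by field_simp; ring
        · simp [hχ.zero x hx, hχ.zero₁ x hx, indicator_of_notMem hx]
      simp only
      linarith
    · rw [integral_add (iJ.const_mul _) iS,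
        integral_add (hi.const_mul _) (ic.const_mul _), integral_const_mul, integral_const_mul,
        integral_const_mul, hic]
      have : 256 * B ^ 4 * C / R ^ 4 * (4 * R) = 1024 * B ^ 4 * C / R ^ 3 := by field_simp; ring
      rw [this]
      have := div_le_self (by positivity : 0 ≤ 1024 * B ^ 4 * C) (one_le_pow₀ hR (n := 3))
      gcongr
  have hY : ∫ x, χ x ^ 4 * (u x * L x ^ 4) ≤ 32 * B ^ 2 * M ^ 2 * N +
      18 * M * ∫ x, χ x ^ 4 * (r x * u x * a x ^ 2) := by
    have iR : Integrable fun x => 32 * B ^ 2 * M ^ 2 * (u x * L x ^ 2) +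
        18 * M * (χ x ^ 4 * (r x * u x * a x ^ 2)) := (hi.const_mul _).add (iJ.const_mul _)
    refine (h.integral_quartic_le hχ).trans ((integral_mono
      (Continuous.integrable_of_hasCompactSupport (by fun_prop)
        (.intro (isCompact_Icc (a := -(2 * R)) (b := 2 * R)) fun x hx => by
          simp [hχ.zero x hx])) iR fun x => ?_).trans ?_)
    · have h1 : χ x ^ 2 * χ₁ x ^ 2 * (r x ^ 2 * u x * L x ^ 2) ≤
          B ^ 2 * (M ^ 2 * (u x * L x ^ 2)) :=
        mul_le_mul ((hχ4 x).trans hR2) (hr2u x _ (hu2 x)) (hr2u0 x) (by positivity)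
      have h2 : r x * (χ x ^ 4 * (r x * u x * a x ^ 2)) ≤
          M * (χ x ^ 4 * (r x * u x * a x ^ 2)) :=
        mul_le_mul_of_nonneg_right (hM x) (mul_nonneg (by positivity)
          (mul_nonneg (mul_pos (h.pos_r x) (h.pos x)).le (sq_nonneg _)))
      simp only
      linarith
    · rw [integral_add (hi.const_mul _) (iJ.const_mul _), integral_const_mul, integral_const_mul]
      gcongr
  have hD : ∫ x, χ x ^ 6 * (1 / 2 * (-K x) * L x ^ 2 + u x * L x * k x) ≤
      144 * B ^ 2 * M / R ^ 2 * (∫ x, χ x ^ 4 * (r x * u x * a x ^ 2)) +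
      36 * (p - 1 / 2) ^ 2 * B ^ 2 / R ^ 2 * (∫ x, χ x ^ 4 * (u x * L x ^ 4)) +
      1296 * B ^ 4 * M ^ 2 * N / R ^ 2 := by
    have iS : Integrable fun x => 144 * B ^ 2 * M / R ^ 2 * (χ x ^ 4 * (r x * u x * a x ^ 2)) +
        36 * (p - 1 / 2) ^ 2 * B ^ 2 / R ^ 2 * (χ x ^ 4 * (u x * L x ^ 4)) :=
      (iJ.const_mul _).add (iY.const_mul _)
    have iR : Integrable fun x => 144 * B ^ 2 * M / R ^ 2 * (χ x ^ 4 * (r x * u x * a x ^ 2)) +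
        36 * (p - 1 / 2) ^ 2 * B ^ 2 / R ^ 2 * (χ x ^ 4 * (u x * L x ^ 4)) +
        1296 * B ^ 4 * M ^ 2 / R ^ 2 * (u x * L x ^ 2) :=
      iS.add (hi.const_mul _)
    refine (h.integral_fisher_le hχ hk ck).trans ((integral_mono
      (Continuous.integrable_of_hasCompactSupport (by fun_prop)
        (.intro (isCompact_Icc (a := -(2 * R)) (b := 2 * R)) fun x hx => by
          simp [hχ.zero x hx])) iR fun x => ?_).trans ?_)
    · have p1 : 0 ≤ r x * u x * a x ^ 2 :=
        mul_nonneg (mul_pos (h.pos_r x) (h.pos x)).le (sq_nonneg _)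
      have h1 : χ x ^ 4 * χ₁ x ^ 2 * (r x ^ 2 * u x * a x ^ 2) ≤
          χ x ^ 4 * (B ^ 2 / R ^ 2) * (M * (r x * u x * a x ^ 2)) := by
        refine mul_le_mul (hχ6 x) ?_ (mul_nonneg (mul_pos (pow_pos (h.pos_r x) 2)
          (h.pos x)).le (sq_nonneg _)) (by positivity)
        have := mul_le_mul_of_nonneg_right (hM x) p1
        linarith
      have h2 := mul_le_mul_of_nonneg_right (hχ6 x)
        (mul_nonneg (sq_nonneg (p - 1 / 2)) (mul_nonneg (h.pos x).le
          (by positivity : 0 ≤ L x ^ 4)))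
      have h3 : (30 * χ x * χ₁ x ^ 2 + 6 * χ x ^ 2 * χ₂ x) ^ 2 * (r x ^ 2 * u x * L x ^ 2) ≤
          1296 * B ^ 4 / R ^ 2 * (M ^ 2 * (u x * L x ^ 2)) := by
        refine mul_le_mul ?_ (hr2u x _ (hu2 x)) (hr2u0 x) (by positivity)
        have h4 : |30 * χ₁ x ^ 2 + 6 * (χ x * χ₂ x)| ≤ 36 * (B ^ 2 / R ^ 2) := by
          have := abs_le.1 (hχ₂ x)
          have := sq₁ x
          have := sq_nonneg (χ₁ x)
          rw [abs_le]; constructor <;> linarith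
        have h5 : |30 * χ x * χ₁ x ^ 2 + 6 * χ x ^ 2 * χ₂ x| ≤ 36 * (B ^ 2 / R ^ 2) := by
          rw [show 30 * χ x * χ₁ x ^ 2 + 6 * χ x ^ 2 * χ₂ x =
            χ x * (30 * χ₁ x ^ 2 + 6 * (χ x * χ₂ x)) by ring, abs_mul, abs_of_nonneg (hχ.nonneg x)]
          exact (mul_le_of_le_one_left (abs_nonneg _) (hχ.le_one x)).trans h4
        rw [← sq_abs]
        refine (pow_le_pow_left₀ (abs_nonneg _) h5 2).trans ?_
        rw [show (36 * (B ^ 2 / R ^ 2)) ^ 2 = 1296 * B ^ 4 / R ^ 4 by field_simp; norm_num]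
        gcongr
        norm_num
      calc _ = 144 * (χ x ^ 4 * χ₁ x ^ 2 * (r x ^ 2 * u x * a x ^ 2)) +
            36 * (χ x ^ 4 * χ₁ x ^ 2 * ((p - 1 / 2) ^ 2 * (u x * L x ^ 4))) +
            (30 * χ x * χ₁ x ^ 2 + 6 * χ x ^ 2 * χ₂ x) ^ 2 * (r x ^ 2 * u x * L x ^ 2) := by ring
        _ ≤ _ := add_le_add (add_le_add (mul_le_mul_of_nonneg_left h1 (by norm_num))
          (mul_le_mul_of_nonneg_left h2 (by norm_num))) h3
        _ = _ := by ring
    · rw [integral_add iS (hi.const_mul _),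
        integral_add (iJ.const_mul _) (iY.const_mul _), integral_const_mul, integral_const_mul,
        integral_const_mul, mul_div_right_comm _ N]
      gcongr
  have h1 := mul_le_mul_of_nonneg_left hE
    (by positivity : 0 ≤ (288 + 1296 * (p - 1 / 2) ^ 2) * B ^ 2 * M / R ^ 2)
  have h2 := mul_le_mul_of_nonneg_left hY
    (by positivity : 0 ≤ 36 * (p - 1 / 2) ^ 2 * B ^ 2 / R ^ 2)
  refine (add_le_add (hD.trans (add_le_add (add_le_add le_rfl h2) le_rfl)) h1).trans (le_of_eq ?_)
  ring

end IsProfile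

/-- Smoothness of a function of space and time on the strip `ℝ × (0, T)`. -/
def SmoothOnStrip (T : ℝ) (f : ℝ → ℝ → ℝ) : Prop :=
  ContDiffOn ℝ (⊤ : ℕ∞) (Function.uncurry f) (univ ×ˢ Ioo 0 T)

/-- The spatial partial derivative. -/
noncomputable def derivSpace (f : ℝ → ℝ → ℝ) (x t : ℝ) : ℝ := deriv (fun y => f y t) x

/-- The temporal partial derivative. -/
noncomputable def derivTime (f : ℝ → ℝ → ℝ) (x t : ℝ) : ℝ := deriv (fun s => f x s) t

namespace SmoothOnStrip

variable {T : ℝ} {f g : ℝ → ℝ → ℝ}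

theorem isOpen_strip : IsOpen ((univ : Set ℝ) ×ˢ Ioo 0 T) := isOpen_univ.prod isOpen_Ioo

theorem contDiffAt (hf : SmoothOnStrip T f) (x : ℝ) {t : ℝ} (ht : t ∈ Ioo 0 T) :
    ContDiffAt ℝ (⊤ : ℕ∞) (Function.uncurry f) (x, t) :=
  ContDiffOn.contDiffAt hf (isOpen_strip.mem_nhds ⟨mem_univ _, ht⟩)

theorem hasDerivAt_fderiv_space (hf : SmoothOnStrip T f) (x : ℝ) {t : ℝ} (ht : t ∈ Ioo 0 T) :
    HasDerivAt (fun y => f y t) (fderiv ℝ (Function.uncurry f) (x, t) (1, 0)) x :=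
  HasFDerivAt.comp_hasDerivAt (f := fun y : ℝ => (y, t)) x
    ((hf.contDiffAt x ht).differentiableAt (by simp)).hasFDerivAt
    ((hasDerivAt_id x).prodMk (hasDerivAt_const x t))

theorem hasDerivAt_fderiv_time (hf : SmoothOnStrip T f) (x : ℝ) {t : ℝ} (ht : t ∈ Ioo 0 T) :
    HasDerivAt (fun s => f x s) (fderiv ℝ (Function.uncurry f) (x, t) (0, 1)) t :=
  HasFDerivAt.comp_hasDerivAt (f := fun s : ℝ => (x, s)) t
    ((hf.contDiffAt x ht).differentiableAt (by simp)).hasFDerivAt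
    ((hasDerivAt_const t x).prodMk (hasDerivAt_id t))

theorem hasDerivAt_space (hf : SmoothOnStrip T f) (x : ℝ) {t : ℝ} (ht : t ∈ Ioo 0 T) :
    HasDerivAt (fun y => f y t) (derivSpace f x t) x :=
  (hf.hasDerivAt_fderiv_space x ht).differentiableAt.hasDerivAt

theorem hasDerivAt_time (hf : SmoothOnStrip T f) (x : ℝ) {t : ℝ} (ht : t ∈ Ioo 0 T) :
    HasDerivAt (fun s => f x s) (derivTime f x t) t :=
  (hf.hasDerivAt_fderiv_time x ht).differentiableAt.hasDerivAt

theorem contDiffOn_fderiv (hf : SmoothOnStrip T f) :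
    ContDiffOn ℝ (⊤ : ℕ∞) (fderiv ℝ (Function.uncurry f)) (univ ×ˢ Ioo 0 T) :=
  ContDiffOn.fderiv_of_isOpen hf isOpen_strip le_rfl

theorem spaceDeriv (hf : SmoothOnStrip T f) : SmoothOnStrip T (derivSpace f) :=
  (hf.contDiffOn_fderiv.clm_apply contDiffOn_const).congr fun x hx =>
    (hf.hasDerivAt_fderiv_space x.1 hx.2).deriv

theorem timeDeriv (hf : SmoothOnStrip T f) : SmoothOnStrip T (derivTime f) :=
  (hf.contDiffOn_fderiv.clm_apply contDiffOn_const).congr fun x hx =>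
    (hf.hasDerivAt_fderiv_time x.1 hx.2).deriv

theorem derivTime_derivSpace (hf : SmoothOnStrip T f) (x : ℝ) {t : ℝ} (ht : t ∈ Ioo 0 T) :
    derivTime (derivSpace f) x t = derivSpace (derivTime f) x t := by
  have hd : HasFDerivAt (fderiv ℝ (Function.uncurry f))
      (fderiv ℝ (fderiv ℝ (Function.uncurry f)) (x, t)) (x, t) :=
    ((hf.contDiffOn_fderiv.contDiffAt (isOpen_strip.mem_nhds ⟨mem_univ x, ht⟩)).differentiableAt
      (by simp)).hasFDerivAt
  have h1 : HasDerivAt (fun s => derivSpace f x s)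
      (fderiv ℝ (fderiv ℝ (Function.uncurry f)) (x, t) (0, 1) (1, 0)) t := by
    have := (HasFDerivAt.comp_hasDerivAt (f := fun s : ℝ => (x, s)) t hd
      ((hasDerivAt_const t x).prodMk (hasDerivAt_id t))).clm_apply (hasDerivAt_const t (1, 0))
    refine (this.congr_deriv (by simp)).congr_of_eventuallyEq ?_
    filter_upwards [isOpen_Ioo.mem_nhds ht] with s hs
    exact (hf.hasDerivAt_fderiv_space x hs).deriv
  have h2 : HasDerivAt (fun y => derivTime f y t)
      (fderiv ℝ (fderiv ℝ (Function.uncurry f)) (x, t) (1, 0) (0, 1)) x := by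
    have := (HasFDerivAt.comp_hasDerivAt (f := fun y : ℝ => (y, t)) x hd
      ((hasDerivAt_id x).prodMk (hasDerivAt_const x t))).clm_apply (hasDerivAt_const x (0, 1))
    refine (this.congr_deriv (by simp)).congr_of_eventuallyEq (.of_forall fun y => ?_)
    exact (hf.hasDerivAt_fderiv_time y ht).deriv
  rw [derivTime, h1.deriv, derivSpace, h2.deriv]
  exact (hf.contDiffAt x ht).isSymmSndFDerivAt
    (by simpa using WithTop.coe_le_coe.2 (le_top (a := (2 : ℕ∞)))) _ _

theorem continuousOn (hf : SmoothOnStrip T f) :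
    ContinuousOn (Function.uncurry f) (univ ×ˢ Ioo 0 T) :=
  ContDiffOn.continuousOn hf

theorem continuous_space (hf : SmoothOnStrip T f) {t : ℝ} (ht : t ∈ Ioo 0 T) :
    Continuous fun x => f x t :=
  continuous_of_hasDerivAt fun x => hf.hasDerivAt_space x ht

theorem mul (hf : SmoothOnStrip T f) (hg : SmoothOnStrip T g) :
    SmoothOnStrip T fun x t => f x t * g x t :=
  ContDiffOn.mul hf hg

theorem pow (hf : SmoothOnStrip T f) (n : ℕ) : SmoothOnStrip T fun x t => f x t ^ n :=
  ContDiffOn.pow hf n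

theorem rpow (hf : SmoothOnStrip T f) (h0 : ∀ x, ∀ t ∈ Ioo 0 T, 0 < f x t) (q : ℝ) :
    SmoothOnStrip T fun x t => f x t ^ q :=
  ContDiffOn.rpow_const_of_ne hf fun x hx => (h0 x.1 x.2 hx.2).ne'

theorem lnp_comp (hf : SmoothOnStrip T f) (h0 : ∀ x, ∀ t ∈ Ioo 0 T, 0 < f x t) (p : ℝ) :
    SmoothOnStrip T fun x t => lnp p (f x t) := by
  unfold lnp
  split_ifs
  · exact ContDiffOn.log hf fun x hx => (h0 x.1 x.2 hx.2).ne'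
  · exact ContDiffOn.div_const (ContDiffOn.sub (hf.rpow h0 (p - 1)) contDiffOn_const) _

theorem continuousOn_integral_mul (hf : SmoothOnStrip T f) {c : ℝ} {φ : ℝ → ℝ}
    (hφ : Continuous φ) (h0 : ∀ x, x ∉ Icc (-c) c → φ x = 0) :
    ContinuousOn (fun t => ∫ x, φ x * f x t) (Ioo 0 T) := by
  refine continuousOn_integral_of_compact_support (k := Icc (-c) c)
    (f := fun t x => φ x * f x t) isCompact_Icc ?_ fun t x _ hx => by simp [h0 x hx]
  refine ((hφ.comp continuous_snd).continuousOn).mul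
    (hf.continuousOn.comp continuous_swap.continuousOn fun x hx => ⟨mem_univ _, hx.1⟩)

theorem hasDerivAt_integral_mul (hf : SmoothOnStrip T f) {c : ℝ} {φ : ℝ → ℝ}
    (hφ : Continuous φ) (h0 : ∀ x, x ∉ Icc (-c) c → φ x = 0) {t : ℝ} (ht : t ∈ Ioo 0 T) :
    HasDerivAt (fun s => ∫ x, φ x * f x s) (∫ x, φ x * derivTime f x t) t := by
  obtain ⟨ε, hε, hball⟩ := Metric.nhds_basis_closedBall.mem_iff.1 (isOpen_Ioo.mem_nhds ht)
  have hcont : ContinuousOn (fun z : ℝ × ℝ => φ z.1 * derivTime f z.1 z.2)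
      (Icc (-c) c ×ˢ Metric.closedBall t ε) :=
    ((hφ.comp continuous_fst).continuousOn).mul
      (hf.timeDeriv.continuousOn.mono (prod_mono (subset_univ _) hball))
  obtain ⟨C, hC⟩ :=
    (isCompact_Icc.prod (isCompact_closedBall t ε)).exists_bound_of_continuousOn hcont
  have hsupp : ∀ g : ℝ → ℝ, Continuous g → Integrable fun x => φ x * g x := fun g hg =>
    (hφ.mul hg).integrable_of_hasCompactSupport
      (.intro (isCompact_Icc (a := -c) (b := c)) fun x hx => by simp [h0 x hx])
  refine (hasDerivAt_integral_of_dominated_loc_of_deriv_le (μ := volume)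
    (F := fun s x => φ x * f x s) (F' := fun s x => φ x * derivTime f x s)
    (bound := (Icc (-c) c).indicator fun _ => C) (Metric.closedBall_mem_nhds t hε) ?_
    (hsupp _ (hf.continuous_space ht))
    (hsupp _ (hf.timeDeriv.continuous_space ht)).aestronglyMeasurable
    (.of_forall fun x s hs => ?_) ((integrable_indicator_iff measurableSet_Icc).2 (by simp))
    (.of_forall fun x s hs => (hf.hasDerivAt_time x (hball hs)).const_mul _)).2
  · filter_upwards [isOpen_Ioo.mem_nhds ht] with s hs
    exact (hsupp _ (hf.continuous_space hs)).aestronglyMeasurable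
  · by_cases hx : x ∈ Icc (-c) c
    · rw [indicator_of_mem hx]
      exact hC (x, s) ⟨hx, hs⟩
    · simp [h0 x hx, indicator_of_notMem hx]

end SmoothOnStrip

theorem hasDerivAt_lnp (p : ℝ) {w : ℝ} (hw : 0 < w) : HasDerivAt (lnp p) (w ^ (p - 1) / w) w := by
  unfold lnp
  by_cases hp : p = 1
  · subst hp
    simpa using Real.hasDerivAt_log hw.ne'
  · simp only [if_neg hp]
    have hp' : p - 1 ≠ 0 := sub_ne_zero.2 hp
    refine HasDerivAt.congr_deriv
      (((Real.hasDerivAt_rpow_const (p := p - 1) (.inl hw.ne')).sub_const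
      1).div_const (p - 1)) ?_
    rw [Real.rpow_sub_one hw.ne' (p - 1)]
    field_simp

/-- An antiderivative of the `p`-logarithm. -/
noncomputable def lnpPrimitive (p w : ℝ) : ℝ := w * lnp p w - w ^ p / p

theorem hasDerivAt_lnpPrimitive {p : ℝ} (hp : p ≠ 0) {w : ℝ} (hw : 0 < w) :
    HasDerivAt (lnpPrimitive p) (lnp p w) w := by
  refine HasDerivAt.congr_deriv (((hasDerivAt_id w).mul (hasDerivAt_lnp p hw)).sub
    ((Real.hasDerivAt_rpow_const (p := p) (.inl hw.ne')).div_const p)) ?_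
  simp only [id]
  field_simp
  ring

theorem exists_mul_lnp_sq_le {p : ℝ} (hp : 1 ≤ p) (M : ℝ) :
    ∃ C, ∀ w, 0 < w → w ≤ M → w * lnp p w ^ 2 ≤ C := by
  suffices ∃ g : ℝ → ℝ, Continuous g ∧ ∀ w, 0 < w → w * lnp p w ^ 2 = g w by
    obtain ⟨g, hg, h⟩ := this
    obtain ⟨C, hC⟩ := (isCompact_Icc (a := 0) (b := M)).exists_bound_of_continuousOn hg.continuousOn
    exact ⟨C, fun w h0 h1 => (h w h0).le.trans ((le_abs_self _).trans (hC w ⟨h0.le, h1⟩))⟩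
  by_cases h1 : p = 1
  · refine ⟨fun w => 4 * (√w * Real.log √w) ^ 2, ?_, fun w hw => ?_⟩
    · have := Real.continuous_mul_log.comp Real.continuous_sqrt
      exact (this.pow 2).const_mul 4
    · rw [lnp, if_pos h1]
      simp only [Real.log_sqrt hw.le, mul_pow, Real.sq_sqrt hw.le]
      ring
  · refine ⟨fun w => w * ((w ^ (p - 1) - 1) / (p - 1)) ^ 2, ?_, fun w _ => by
      rw [lnp, if_neg h1]⟩
    have := Real.continuous_rpow_const (sub_nonneg.2 hp)
    fun_prop

theorem exists_abs_lnpPrimitive_le {p : ℝ} (hp : 1 ≤ p) (M : ℝ) :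
    ∃ C, ∀ w, 0 < w → w ≤ M → |lnpPrimitive p w| ≤ C := by
  obtain ⟨C, hC⟩ := exists_mul_lnp_sq_le hp M
  refine ⟨(M + C) / 2 + M ^ p / p, fun w h0 h1 => ?_⟩
  have hw := hC w h0 h1
  have h2 : w ^ p / p ≤ M ^ p / p := by gcongr
  have h3 : 0 ≤ w ^ p / p := by positivity
  have h4 := mul_nonneg h0.le (sq_nonneg (lnp p w - 1))
  have h5 := mul_nonneg h0.le (sq_nonneg (lnp p w + 1))
  rw [lnpPrimitive, abs_le]
  constructor <;> nlinarith

/-- The `p`-logarithm of a density. -/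
noncomputable def lnpOf (p : ℝ) (u : ℝ → ℝ → ℝ) : ℝ → ℝ → ℝ := fun x t => lnp p (u x t)

/-- The density `u ^ p ∂ₓ² (ln_p u)`. -/
noncomputable def fluxPotential (p : ℝ) (u : ℝ → ℝ → ℝ) : ℝ → ℝ → ℝ :=
  fun x t => u x t ^ p * derivSpace (derivSpace (lnpOf p u)) x t

/-- Integrability and positivity of a smooth solution of the fourth-order equation
`∂ₜ u = -∂ₓ² (u ^ p ∂ₓ² (ln_p u))` whose time slices are probability densities with finite second
moment and finite generalized Fisher information. -/
structure IsSolution (p T : ℝ) (u : ℝ → ℝ → ℝ) : Prop where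
  one_le : 1 ≤ p
  smooth : SmoothOnStrip T u
  pos : ∀ x, ∀ t ∈ Ioo 0 T, 0 < u x t
  pde : ∀ x, ∀ t ∈ Ioo 0 T, derivTime u x t = -derivSpace (derivSpace (fluxPotential p u)) x t
  integrable : ∀ t ∈ Ioo 0 T, Integrable fun x => u x t
  integral_eq_one : ∀ t ∈ Ioo 0 T, ∫ x, u x t = 1
  tendsto_atBot : ∀ t ∈ Ioo 0 T, Tendsto (fun x => u x t) atBot (nhds 0)
  integrable_moment : ∀ t ∈ Ioo 0 T, Integrable fun x => x ^ 2 * u x t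
  integrable_fisher : ∀ t ∈ Ioo 0 T, Integrable fun x => u x t * derivSpace (lnpOf p u) x t ^ 2

namespace IsSolution

variable {p T : ℝ} {u : ℝ → ℝ → ℝ}

theorem smooth_lnpOf (h : IsSolution p T u) : SmoothOnStrip T (lnpOf p u) :=
  h.smooth.lnp_comp h.pos p

theorem smooth_fluxPotential (h : IsSolution p T u) : SmoothOnStrip T (fluxPotential p u) :=
  (h.smooth.rpow h.pos p).mul h.smooth_lnpOf.spaceDeriv.spaceDeriv

theorem derivSpace_eq (h : IsSolution p T u) (x : ℝ) {t : ℝ} (ht : t ∈ Ioo 0 T) :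
    derivSpace u x t = u x t * derivSpace (lnpOf p u) x t / u x t ^ (p - 1) := by
  have h0 := h.pos x t ht
  have h1 := (Real.rpow_pos_of_pos h0 (p - 1)).ne'
  have h2 : derivSpace (lnpOf p u) x t = u x t ^ (p - 1) / u x t * derivSpace u x t :=
    ((hasDerivAt_lnp p h0).comp x (h.smooth.hasDerivAt_space x ht)).deriv
  rw [h2]
  field_simp

theorem derivTime_lnpOf (h : IsSolution p T u) (x : ℝ) {t : ℝ} (ht : t ∈ Ioo 0 T) :
    derivTime (lnpOf p u) x t =
      u x t ^ (p - 1) / u x t * -derivSpace (derivSpace (fluxPotential p u)) x t := by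
  rw [← h.pde x t ht]
  exact ((hasDerivAt_lnp p (h.pos x t ht)).comp t (h.smooth.hasDerivAt_time x ht)).deriv

theorem isProfile (h : IsSolution p T u) {t : ℝ} (ht : t ∈ Ioo 0 T) :
    IsProfile p (fun x => u x t) (fun x => u x t ^ (p - 1)) (fun x => lnpOf p u x t)
      (fun x => derivSpace (lnpOf p u) x t) (fun x => derivSpace (derivSpace (lnpOf p u)) x t)
      (fun x => derivSpace (derivSpace (derivSpace (lnpOf p u))) x t)
      (fun x => derivSpace (derivSpace (fluxPotential p u)) x t) where
  one_le := h.one_le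
  pos x := h.pos x t ht
  pos_r x := Real.rpow_pos_of_pos (h.pos x t ht) _
  hasDerivAt_u x := by
    rw [← h.derivSpace_eq x ht]
    exact h.smooth.hasDerivAt_space x ht
  hasDerivAt_r x := by
    have h0 := h.pos x t ht
    have h1 := (Real.rpow_pos_of_pos h0 (p - 1)).ne'
    refine ((h.smooth.hasDerivAt_space x ht).rpow_const (p := p - 1) (.inl h0.ne')).congr_deriv ?_
    rw [h.derivSpace_eq x ht, Real.rpow_sub_one h0.ne' (p - 1)]
    field_simp
  hasDerivAt_l x := h.smooth_lnpOf.hasDerivAt_space x ht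
  hasDerivAt_L x := h.smooth_lnpOf.spaceDeriv.hasDerivAt_space x ht
  hasDerivAt_a x := h.smooth_lnpOf.spaceDeriv.spaceDeriv.hasDerivAt_space x ht
  hasDerivAt_flux x := by
    refine (h.smooth_fluxPotential.spaceDeriv.hasDerivAt_space x ht).congr_of_eventuallyEq
      (.of_forall fun y => ?_)
    have h0 := h.pos y t ht
    have h1 := (Real.rpow_pos_of_pos h0 (p - 1)).ne'
    have h2 : u y t ^ p = u y t ^ (p - 1) * u y t := by
      rw [Real.rpow_sub_one h0.ne']
      field_simp
    have := (((h.smooth.hasDerivAt_space y ht).rpow_const (p := p) (.inl h0.ne')).mul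
      (h.smooth_lnpOf.spaceDeriv.spaceDeriv.hasDerivAt_space y ht)).deriv
    refine Eq.symm (Eq.trans this ?_)
    rw [h.derivSpace_eq y ht, h2]
    field_simp
  continuous_b := h.smooth_lnpOf.spaceDeriv.spaceDeriv.spaceDeriv.continuous_space ht
  continuous_K := h.smooth_fluxPotential.spaceDeriv.spaceDeriv.continuous_space ht

theorem hasDerivAt_derivTime_lnpOf (h : IsSolution p T u) (x : ℝ) {t : ℝ} (ht : t ∈ Ioo 0 T) :
    HasDerivAt (fun x => u x t ^ (p - 1) / u x t *
      -derivSpace (derivSpace (fluxPotential p u)) x t)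
      (derivTime (derivSpace (lnpOf p u)) x t) x := by
  rw [h.smooth_lnpOf.derivTime_derivSpace x ht]
  exact (h.smooth_lnpOf.timeDeriv.hasDerivAt_space x ht).congr_of_eventuallyEq
    (.of_forall fun y => (h.derivTime_lnpOf y ht).symm)

/-- A bound on the Fisher information bounds the density. -/
theorem le_of_fisher_le (h : IsSolution p T u) {t N : ℝ} (ht : t ∈ Ioo 0 T)
    (hN : ∫ x, u x t * derivSpace (lnpOf p u) x t ^ 2 ≤ N) (x : ℝ) :
    u x t ≤ max 1 (p / 2 * (1 + N)) := by
  have h2 : ∀ y, u y t ^ (p - 1) * u y t = u y t ^ p := fun y => by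
    have h0 := (h.pos y t ht).ne'
    rw [Real.rpow_sub_one h0]
    field_simp
  have hp := h.one_le
  have := (h.isProfile ht).mul_le_of_fisher_le (h.integrable t ht) (h.integral_eq_one t ht)
    (h.integrable_fisher t ht) hN (by
      simp only [h2]
      have := (h.tendsto_atBot t ht).rpow_const (p := p) (.inr (by linarith))
      rwa [Real.zero_rpow (by linarith)] at this) x
  rw [h2] at this
  rcases le_total (u x t) 1 with h1 | h1
  · exact h1.trans (le_max_left _ _)
  · exact (Real.self_le_rpow_of_one_le h1 hp).trans (this.trans (le_max_right _ _))

end IsSolution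

theorem deriv_eq_zero_of_notMem_Icc {g : ℝ → ℝ} {a b : ℝ} (h : ∀ x, x ∉ Icc a b → g x = 0) (x : ℝ)
    (hx : x ∉ Icc a b) : deriv g x = 0 := by
  have : g =ᶠ[nhds x] fun _ => 0 := by
    filter_upwards [isClosed_Icc.isOpen_compl.mem_nhds hx] with y hy using h y hy
  rw [this.deriv_eq, deriv_const]

theorem exists_abs_le_of_eq_zero_notMem_Icc {g : ℝ → ℝ} {a b : ℝ} (hg : Continuous g)
    (h : ∀ x, x ∉ Icc a b → g x = 0) : ∃ B, ∀ x, |g x| ≤ B := by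
  obtain ⟨B, hB⟩ := (isCompact_Icc (a := a) (b := b)).exists_bound_of_continuousOn hg.continuousOn
  refine ⟨max B 0, fun x => ?_⟩
  by_cases hx : x ∈ Icc a b
  · exact (hB x hx).trans (le_max_left _ _)
  · simp [h x hx]

theorem div_notMem_Icc {R x : ℝ} (hR : 0 < R) (hx : x ∉ Icc (-(2 * R)) (2 * R)) :
    x / R ∉ Icc (-2 : ℝ) 2 := by
  refine fun h => hx ?_
  have h1 := (le_div_iff₀ hR).1 h.1
  have h2 := (div_le_iff₀ hR).1 h.2
  exact ⟨by linarith, h2⟩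

theorem hasDerivAt_comp_div {g : ℝ → ℝ} {g' : ℝ} {x R : ℝ} (hg : HasDerivAt g g' (x / R)) :
    HasDerivAt (fun x => g (x / R)) (g' / R) x := by
  refine (HasDerivAt.comp x hg ((hasDerivAt_id x).div_const R)).congr_deriv ?_
  ring

theorem exists_bump : ∃ χ : ℝ → ℝ, ContDiff ℝ (⊤ : ℕ∞) χ ∧ (∀ x, 0 ≤ χ x) ∧ (∀ x, χ x ≤ 1) ∧
    (∀ x, |x| ≤ 1 → χ x = 1) ∧ ∀ x, x ∉ Icc (-2) 2 → χ x = 0 := by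
  let χ : ContDiffBump (0 : ℝ) := ⟨1, 2, one_pos, one_lt_two⟩
  refine ⟨χ, χ.contDiff, fun x => χ.nonneg, fun x => χ.le_one, fun x hx =>
    χ.one_of_mem_closedBall (by simpa using hx), fun x hx => χ.zero_of_le_dist ?_⟩
  rw [Real.dist_eq, sub_zero]
  by_contra! h
  exact hx ⟨(abs_lt.1 h).1.le, (abs_lt.1 h).2.le⟩

theorem exists_cutoffs : ∃ B : ℝ, 1 ≤ B ∧ ∃ χ χ₁ χ₂ : ℝ → ℝ → ℝ, ∀ R, 1 ≤ R →
    IsCutoff (2 * R) (χ R) (χ₁ R) (χ₂ R) ∧ (∀ x, |χ₁ R x| ≤ B / R) ∧ (∀ x, |χ₂ R x| ≤ B / R ^ 2) ∧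
      ∀ x, |x| ≤ R → χ R x = 1 := by
  obtain ⟨χ, hs, h0, h1, hone, hz⟩ := exists_bump
  have hs₁ : ContDiff ℝ (⊤ : ℕ∞) (deriv χ) := (contDiff_infty_iff_deriv.1 hs).2
  have hs₂ : ContDiff ℝ (⊤ : ℕ∞) (deriv (deriv χ)) := (contDiff_infty_iff_deriv.1 hs₁).2
  have hz₁ := deriv_eq_zero_of_notMem_Icc hz
  have hz₂ := deriv_eq_zero_of_notMem_Icc hz₁
  obtain ⟨B₁, hB₁⟩ := exists_abs_le_of_eq_zero_notMem_Icc hs₁.continuous hz₁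
  obtain ⟨B₂, hB₂⟩ := exists_abs_le_of_eq_zero_notMem_Icc hs₂.continuous hz₂
  refine ⟨max 1 (max B₁ B₂), le_max_left _ _, fun R x => χ (x / R), fun R x => deriv χ (x / R) / R,
    fun R x => deriv (deriv χ) (x / R) / R ^ 2, fun R hR => ?_⟩
  have R0 : 0 < R := by linarith
  refine ⟨⟨fun x => h0 _, fun x => h1 _, fun x => ?_, fun x => ?_, ?_, fun x hx => ?_,
    fun x hx => ?_, fun x hx => ?_⟩, fun x => ?_, fun x => ?_, fun x hx => hone _ ?_⟩
  · exact hasDerivAt_comp_div ((hs.differentiable (by simp)) _).hasDerivAt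
  · refine ((hasDerivAt_comp_div ((hs₁.differentiable (by simp)) _).hasDerivAt).div_const
      R).congr_deriv ?_
    simp only [div_div, sq]
  · exact (hs₂.continuous.comp (continuous_id.div_const R)).div_const _
  · exact hz _ (div_notMem_Icc R0 hx)
  · simp only [hz₁ _ (div_notMem_Icc R0 hx), zero_div]
  · simp only [hz₂ _ (div_notMem_Icc R0 hx), zero_div]
  · rw [abs_div, abs_of_pos R0]
    gcongr
    exact (hB₁ _).trans ((le_max_left _ _).trans (le_max_right _ _))
  · rw [abs_div, abs_of_pos (pow_pos R0 2)]
    gcongr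
    exact (hB₂ _).trans ((le_max_right _ _).trans (le_max_right _ _))
  · rwa [abs_div, abs_of_pos R0, div_le_one R0]

theorem tendsto_integral_mul_of_eq_one {φ : ℝ → ℝ → ℝ} {B : ℝ} {f : ℝ → ℝ}
    (hφ : ∀ R, 1 ≤ R → Continuous (φ R)) (hB : ∀ R, 1 ≤ R → ∀ x, |φ R x| ≤ B) {c : ℝ}
    (h1 : ∀ R, 1 ≤ R → ∀ x, |x| < R → φ R x = c) (hf : Integrable f) :
    Tendsto (fun n : ℕ => ∫ x, φ (n + 1) x * f x) atTop (nhds (∫ x, c * f x)) := by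
  have hn : ∀ n : ℕ, (1 : ℝ) ≤ n + 1 := fun n => by simp
  refine tendsto_integral_of_dominated_convergence (fun x => B * |f x|)
    (fun n => (hφ _ (hn n)).aestronglyMeasurable.mul hf.aestronglyMeasurable)
    (hf.abs.const_mul B) (fun n => .of_forall fun x => ?_) (.of_forall fun x => ?_)
  · rw [norm_mul]
    exact mul_le_mul_of_nonneg_right (hB _ (hn n) x) (abs_nonneg _)
  · refine tendsto_const_nhds.congr' ?_
    obtain ⟨m, hm⟩ := exists_nat_gt |x|
    filter_upwards [eventually_ge_atTop m] with n hmn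
    rw [h1 _ (hn n) x]
    have : (m : ℝ) ≤ n := by exact_mod_cast hmn
    linarith

namespace IsSolution

variable {p T : ℝ} {u : ℝ → ℝ → ℝ}

/-- Along a time interval on which the generalized Fisher information is bounded, it cannot
increase. -/
theorem fisher_le_of_bounded (h : IsSolution p T u) {t₀ t₁ N : ℝ} (ht₀ : t₀ ∈ Ioo 0 T)
    (ht₁ : t₁ ∈ Ioo 0 T) (h01 : t₀ ≤ t₁)
    (hN : ∀ t ∈ Icc t₀ t₁, ∫ x, u x t * derivSpace (lnpOf p u) x t ^ 2 ≤ N) :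
    ∫ x, u x t₁ * derivSpace (lnpOf p u) x t₁ ^ 2 ≤
      ∫ x, u x t₀ * derivSpace (lnpOf p u) x t₀ ^ 2 := by
  have hp := h.one_le
  have hsub : Icc t₀ t₁ ⊆ Ioo 0 T := fun t ht => ⟨ht₀.1.trans_le ht.1, ht.2.trans_lt ht₁.2⟩
  obtain ⟨B, hB1, χ, χ₁, χ₂, hχ⟩ := exists_cutoffs
  obtain ⟨M, hM⟩ : ∃ M, M = max 1 (p / 2 * (1 + N)) := ⟨_, rfl⟩
  have hM1 : 1 ≤ M := hM ▸ le_max_left _ _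
  have huM : ∀ t ∈ Icc t₀ t₁, ∀ x, u x t ≤ M := fun t ht x =>
    hM ▸ h.le_of_fisher_le (hsub ht) (hN t ht) x
  obtain ⟨C, hC⟩ := exists_mul_lnp_sq_le hp M
  obtain ⟨C', hC'⟩ := exists_abs_lnpPrimitive_le hp M
  obtain ⟨A, hA⟩ : ∃ A, A = (288 + 1296 * (p - 1 / 2) ^ 2) * B ^ 2 * M ^ (p - 1) := ⟨_, rfl⟩
  have hA0 : 0 ≤ A := by rw [hA]; positivity
  obtain ⟨E, hE⟩ : ∃ E, E = 1152 * (p - 1 / 2) ^ 2 * B ^ 4 * (M ^ (p - 1)) ^ 2 * N +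
      1296 * B ^ 4 * (M ^ (p - 1)) ^ 2 * N + (288 + 1296 * (p - 1 / 2) ^ 2) * B ^ 2 * M ^ (p - 1) *
        (64 * B ^ 2 * M ^ (p - 1) * N + 1024 * B ^ 4 * (M ^ (p - 1) * C)) := ⟨_, rfl⟩
  have smF : SmoothOnStrip T fun x t => 1 / 2 * (u x t * derivSpace (lnpOf p u) x t ^ 2) :=
    contDiffOn_const.mul (h.smooth.mul (h.smooth_lnpOf.spaceDeriv.pow 2))
  have smE : SmoothOnStrip T fun x t => lnpPrimitive p (u x t) :=
    ContDiffOn.sub (h.smooth.mul h.smooth_lnpOf) (ContDiffOn.div_const (h.smooth.rpow h.pos p) p)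
  have dF : ∀ x, ∀ t ∈ Ioo 0 T,
      derivTime (fun x t => 1 / 2 * (u x t * derivSpace (lnpOf p u) x t ^ 2)) x t =
        1 / 2 * -derivSpace (derivSpace (fluxPotential p u)) x t * derivSpace (lnpOf p u) x t ^ 2 +
          u x t * derivSpace (lnpOf p u) x t * derivTime (derivSpace (lnpOf p u)) x t := by
    intro x t ht
    rw [← h.pde x t ht]
    refine ((((h.smooth.hasDerivAt_time x ht).mul
      ((h.smooth_lnpOf.spaceDeriv.hasDerivAt_time x ht).pow 2)).const_mul (1 / 2)).congr_deriv
        ?_).deriv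
    simp only [Pi.pow_apply]
    ring
  have dE : ∀ x, ∀ t ∈ Ioo 0 T, derivTime (fun x t => lnpPrimitive p (u x t)) x t =
      lnpOf p u x t * -derivSpace (derivSpace (fluxPotential p u)) x t := by
    intro x t ht
    rw [← h.pde x t ht]
    exact ((hasDerivAt_lnpPrimitive (by linarith) (h.pos x t ht)).comp t
      (h.smooth.hasDerivAt_time x ht)).deriv
  have key : ∀ R : ℝ, 1 ≤ R →
      ((∫ x, χ R x ^ 6 * (1 / 2 * (u x t₁ * derivSpace (lnpOf p u) x t₁ ^ 2))) +
        A / R ^ 2 * ∫ x, χ R x ^ 4 * lnpPrimitive p (u x t₁)) -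
      ((∫ x, χ R x ^ 6 * (1 / 2 * (u x t₀ * derivSpace (lnpOf p u) x t₀ ^ 2))) +
        A / R ^ 2 * ∫ x, χ R x ^ 4 * lnpPrimitive p (u x t₀)) ≤ E / R ^ 2 * (t₁ - t₀) := by
    intro R hR
    obtain ⟨hc, hc₁, hc₂, -⟩ := hχ R hR
    have hd : ∀ t ∈ Icc t₀ t₁, HasDerivAt (fun t =>
        (∫ x, χ R x ^ 6 * (1 / 2 * (u x t * derivSpace (lnpOf p u) x t ^ 2))) +
          A / R ^ 2 * ∫ x, χ R x ^ 4 * lnpPrimitive p (u x t)) _ t := fun t ht =>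
      (smF.hasDerivAt_integral_mul (c := 2 * R) (hc.continuous.pow 6)
          (fun x hx => by simp [hc.zero x hx])
        (hsub ht)).add ((smE.hasDerivAt_integral_mul (c := 2 * R)
          (hc.continuous.pow 4) (fun x hx => by simp [hc.zero x hx])
          (hsub ht)).const_mul (A / R ^ 2))
    refine (convex_Icc t₀ t₁).image_sub_le_mul_sub_of_deriv_le
      (fun t ht => (hd t ht).continuousAt.continuousWithinAt)
      (fun t ht => (hd t (interior_subset ht)).differentiableAt.differentiableWithinAt)
      (fun t ht => ?_) t₀ (left_mem_Icc.2 h01) t₁ (right_mem_Icc.2 h01) h01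
    have ht := interior_subset ht
    rw [(hd t ht).deriv]
    simp only [dF _ t (hsub ht), dE _ t (hsub ht)]
    rw [hA, hE]
    exact (h.isProfile (hsub ht)).dissipation_le hR hc hc₁ hc₂ hB1
      (fun x => Real.rpow_le_rpow (h.pos x t (hsub ht)).le (huM t ht x) (by linarith))
      (h.integrable_fisher t (hsub ht)) (hN t ht) (fun x => by
        rw [mul_assoc]
        have h0 := h.pos x t (hsub ht)
        exact mul_le_mul (Real.rpow_le_rpow h0.le (huM t ht x) (by linarith))
          (hC _ h0 (huM t ht x)) (mul_nonneg h0.le (sq_nonneg _)) (by positivity))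
      (fun x => h.hasDerivAt_derivTime_lnpOf x (hsub ht))
      (h.smooth_lnpOf.spaceDeriv.timeDeriv.continuous_space (hsub ht))
  have hent : ∀ t ∈ Icc t₀ t₁, ∀ R : ℝ, 1 ≤ R →
      |∫ x, χ R x ^ 4 * lnpPrimitive p (u x t)| ≤ 4 * C' * R := by
    intro t ht R hR
    obtain ⟨hc, -⟩ := hχ R hR
    have hb : ∀ x, ‖χ R x ^ 4 * lnpPrimitive p (u x t)‖ ≤
        (Icc (-(2 * R)) (2 * R)).indicator (fun _ => C') x := by
      intro x
      by_cases hx : x ∈ Icc (-(2 * R)) (2 * R)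
      · rw [indicator_of_mem hx, norm_mul, norm_pow, Real.norm_of_nonneg (hc.nonneg x)]
        exact (mul_le_of_le_one_left (norm_nonneg _)
          (pow_le_one₀ (hc.nonneg x) (hc.le_one x))).trans
            (hC' _ (h.pos x t (hsub ht)) (huM t ht x))
      · simp [hc.zero x hx, indicator_of_notMem hx]
    refine (norm_integral_le_of_norm_le ((integrable_indicator_iff measurableSet_Icc).2 (by simp))
      (.of_forall hb)).trans (le_of_eq ?_)
    rw [integral_indicator measurableSet_Icc]
    simp only [integral_const, MeasurableSet.univ, measureReal_restrict_apply, univ_inter,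
      Real.volume_real_Icc, smul_eq_mul]
    rw [max_eq_left (by linarith)]
    ring
  have lim : ∀ t ∈ Icc t₀ t₁, Tendsto (fun n : ℕ =>
      ∫ x, χ (n + 1) x ^ 6 * (1 / 2 * (u x t * derivSpace (lnpOf p u) x t ^ 2))) atTop
      (nhds (∫ x, 1 * (1 / 2 * (u x t * derivSpace (lnpOf p u) x t ^ 2)))) := fun t ht =>
    tendsto_integral_mul_of_eq_one (φ := fun R x => χ R x ^ 6) (B := 1)
      (fun R hR => (hχ R hR).1.continuous.pow 6) (fun R hR x => by
        rw [abs_pow, abs_of_nonneg ((hχ R hR).1.nonneg x)]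
        exact pow_le_one₀ ((hχ R hR).1.nonneg x) ((hχ R hR).1.le_one x))
      (fun R hR x hx => by simp [(hχ R hR).2.2.2 x hx.le])
      ((h.integrable_fisher t (hsub ht)).const_mul _)
  have lim' : Tendsto (fun n : ℕ => (|E| * (t₁ - t₀) + 8 * A * C') * (1 / ((n : ℝ) + 1))) atTop
      (nhds ((|E| * (t₁ - t₀) + 8 * A * C') * 0)) :=
    tendsto_one_div_add_atTop_nhds_zero_nat.const_mul _
  have := le_of_tendsto_of_tendsto' ((lim t₁ (right_mem_Icc.2 h01)).sub
    (lim t₀ (left_mem_Icc.2 h01))) lim' fun n => ?_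
  · simp only [one_mul, integral_const_mul] at this
    linarith
  · obtain ⟨R, hRn⟩ : ∃ R : ℝ, R = n + 1 := ⟨_, rfl⟩
    rw [← hRn]
    have hR : 1 ≤ R := by simp [hRn]
    have R0 : 0 < R := by linarith
    have h1 := abs_le.1 (hent t₁ (right_mem_Icc.2 h01) R hR)
    have h0 := abs_le.1 (hent t₀ (left_mem_Icc.2 h01) R hR)
    have h2 : A / R ^ 2 * ((∫ x, χ R x ^ 4 * lnpPrimitive p (u x t₀)) -
        ∫ x, χ R x ^ 4 * lnpPrimitive p (u x t₁)) ≤ A / R ^ 2 * (8 * C' * R) :=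
      mul_le_mul_of_nonneg_left (by linarith) (by positivity)
    have h3 : A / R ^ 2 * (8 * C' * R) = 8 * A * C' * (1 / R) := by field_simp
    have h4 : E / R ^ 2 * (t₁ - t₀) ≤ |E| * (t₁ - t₀) * (1 / R) := by
      have : E / R ^ 2 ≤ |E| / R :=
        div_le_div₀ (abs_nonneg E) (le_abs_self E) R0 (le_self_pow₀ hR two_ne_zero)
      refine (mul_le_mul_of_nonneg_right this (sub_nonneg.2 h01)).trans (le_of_eq ?_)
      ring
    have := key R hR
    linarith

end IsSolution

theorem exists_moment_tests : ∃ B : ℝ, 0 ≤ B ∧ ∃ χ ψ ψ₁ ψ₂ ψ₃ ψ₄ : ℝ → ℝ → ℝ, ∀ R, 1 ≤ R →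
    (Continuous (χ R) ∧ (∀ x, |χ R x| ≤ 1) ∧ (∀ x, |x| < R → χ R x = 1) ∧
      ∀ x, ψ R x = χ R x * x ^ 2) ∧
    ((∀ x, HasDerivAt (ψ R) (ψ₁ R x) x) ∧ (∀ x, HasDerivAt (ψ₁ R) (ψ₂ R x) x) ∧
      (∀ x, HasDerivAt (ψ₂ R) (ψ₃ R x) x) ∧ (∀ x, HasDerivAt (ψ₃ R) (ψ₄ R x) x) ∧
      Continuous (ψ₄ R)) ∧
    ((∀ x, x ∉ Icc (-(2 * R)) (2 * R) → ψ R x = 0) ∧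
      (∀ x, x ∉ Icc (-(2 * R)) (2 * R) → ψ₁ R x = 0) ∧
      (∀ x, x ∉ Icc (-(2 * R)) (2 * R) → ψ₂ R x = 0) ∧
      (∀ x, x ∉ Icc (-(2 * R)) (2 * R) → ψ₃ R x = 0) ∧
      ∀ x, x ∉ Icc (-(2 * R)) (2 * R) → ψ₄ R x = 0) ∧
    (∀ x, |x| < R → ψ₂ R x = 2) ∧ (∀ x, |ψ₂ R x| ≤ B) ∧ ∀ x, |ψ₄ R x| ≤ B / R ^ 2 := by
  obtain ⟨χ, hs, h0, h1, hone, hz⟩ := exists_bump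
  obtain ⟨g, hg⟩ : ∃ g : ℝ → ℝ, g = fun x => χ x * x ^ 2 := ⟨_, rfl⟩
  have s₀ : ContDiff ℝ (⊤ : ℕ∞) g := hg ▸ hs.mul (contDiff_id.pow 2)
  have s₁ := (contDiff_infty_iff_deriv.1 s₀).2
  have s₂ := (contDiff_infty_iff_deriv.1 s₁).2
  have s₃ := (contDiff_infty_iff_deriv.1 s₂).2
  have s₄ := (contDiff_infty_iff_deriv.1 s₃).2
  have z₀ : ∀ x, x ∉ Icc (-2) 2 → g x = 0 := fun x hx => by simp [hg, hz x hx]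
  have z₁ := deriv_eq_zero_of_notMem_Icc z₀
  have z₂ := deriv_eq_zero_of_notMem_Icc z₁
  have z₃ := deriv_eq_zero_of_notMem_Icc z₂
  have z₄ := deriv_eq_zero_of_notMem_Icc z₃
  obtain ⟨B₂, hB₂⟩ := exists_abs_le_of_eq_zero_notMem_Icc s₂.continuous z₂
  obtain ⟨B₄, hB₄⟩ := exists_abs_le_of_eq_zero_notMem_Icc s₄.continuous z₄
  have two : ∀ x, |x| < 1 → deriv (deriv g) x = 2 := fun x hx => by
    have hev : ∀ y, |y| < 1 → deriv g y = 2 * y := fun y hy => by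
      have : g =ᶠ[nhds y] fun z => z ^ 2 := by
        filter_upwards [(isOpen_lt continuous_abs continuous_const).mem_nhds hy] with z hz
        simp [hg, hone z (le_of_lt hz)]
      rw [this.deriv_eq]
      simp
    have : deriv g =ᶠ[nhds x] fun y => 2 * y := by
      filter_upwards [(isOpen_lt continuous_abs continuous_const).mem_nhds hx] with y hy
        using hev y hy
    rw [this.deriv_eq, deriv_const_mul _ differentiableAt_id, deriv_id'', mul_one]
  refine ⟨max B₂ B₄, ((abs_nonneg _).trans (hB₂ 0)).trans (le_max_left _ _),
    fun R x => χ (x / R), fun R x => R ^ 2 * g (x / R), fun R x => R * deriv g (x / R),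
    fun R x => deriv (deriv g) (x / R), fun R x => deriv (deriv (deriv g)) (x / R) / R,
    fun R x => deriv (deriv (deriv (deriv g))) (x / R) / R ^ 2, fun R hR => ?_⟩
  have R0 : 0 < R := by linarith
  have lt1 : ∀ x, |x| < R → |x / R| < 1 := fun x hx => by
    rwa [abs_div, abs_of_pos R0, div_lt_one R0]
  refine ⟨⟨hs.continuous.comp (continuous_id.div_const R), fun x => ?_, fun x hx =>
    hone _ (lt1 x hx).le, fun x => ?_⟩, ⟨fun x => ?_, fun x => ?_, fun x => ?_, fun x => ?_, ?_⟩,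
    ⟨fun x hx => ?_, fun x hx => ?_, fun x hx => ?_, fun x hx => ?_, fun x hx => ?_⟩,
    fun x hx => two _ (lt1 x hx), fun x => (hB₂ _).trans (le_max_left _ _), fun x => ?_⟩
  · rw [abs_of_nonneg (h0 _)]
    exact h1 _
  · simp only [hg]
    field_simp
  · refine ((hasDerivAt_comp_div ((s₀.differentiable (by simp)) _).hasDerivAt).const_mul
      (R ^ 2)).congr_deriv ?_
    field_simp
  · refine ((hasDerivAt_comp_div ((s₁.differentiable (by simp)) _).hasDerivAt).const_mul
      R).congr_deriv ?_
    field_simp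
  · exact hasDerivAt_comp_div ((s₂.differentiable (by simp)) _).hasDerivAt
  · refine ((hasDerivAt_comp_div ((s₃.differentiable (by simp)) _).hasDerivAt).div_const
      R).congr_deriv ?_
    field_simp
  · exact (s₄.continuous.comp (continuous_id.div_const R)).div_const _
  · simp only [z₀ _ (div_notMem_Icc R0 hx), mul_zero]
  · simp only [z₁ _ (div_notMem_Icc R0 hx), mul_zero]
  · exact z₂ _ (div_notMem_Icc R0 hx)
  · simp only [z₃ _ (div_notMem_Icc R0 hx), zero_div]
  · simp only [z₄ _ (div_notMem_Icc R0 hx), zero_div]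
  · rw [abs_div, abs_of_pos (pow_pos R0 2)]
    gcongr
    exact (hB₄ _).trans (le_max_right _ _)

namespace IsSolution

variable {p T : ℝ} {u : ℝ → ℝ → ℝ}

theorem moment_sub_eq (h : IsSolution p T u) {t₀ t₁ N : ℝ} (ht₀ : t₀ ∈ Ioo 0 T)
    (ht₁ : t₁ ∈ Ioo 0 T) (h01 : t₀ ≤ t₁)
    (hN : ∀ t ∈ Icc t₀ t₁, ∫ x, u x t * derivSpace (lnpOf p u) x t ^ 2 ≤ N) :
    IntervalIntegrable (fun t => 2 * p * ∫ x, u x t * derivSpace (lnpOf p u) x t ^ 2) volume t₀ t₁ ∧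
    (∫ x, x ^ 2 * u x t₁) - ∫ x, x ^ 2 * u x t₀ =
      ∫ t in t₀..t₁, 2 * p * ∫ x, u x t * derivSpace (lnpOf p u) x t ^ 2 := by
  have hp := h.one_le
  have hsub : Icc t₀ t₁ ⊆ Ioo 0 T := fun t ht => ⟨ht₀.1.trans_le ht.1, ht.2.trans_lt ht₁.2⟩
  obtain ⟨B, hB, χ, ψ, ψ₁, ψ₂, ψ₃, ψ₄, hψ⟩ := exists_moment_tests
  obtain ⟨M, hM⟩ : ∃ M, M = max 1 (p / 2 * (1 + N)) := ⟨_, rfl⟩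
  have hM1 : 1 ≤ M := hM ▸ le_max_left _ _
  have hrM : ∀ t ∈ Icc t₀ t₁, ∀ x, (u x t ^ (p - 1)) ^ 2 ≤ (M ^ (p - 1)) ^ 2 := fun t ht x => by
    have h0 := h.pos x t (hsub ht)
    have h1 : u x t ≤ M := hM ▸ h.le_of_fisher_le (hsub ht) (hN t ht) x
    gcongr
  have hn : ∀ n : ℕ, (1 : ℝ) ≤ n + 1 := fun n => by simp
  have fisher_nonneg : ∀ t ∈ Icc t₀ t₁, ∀ x, 0 ≤ u x t * derivSpace (lnpOf p u) x t ^ 2 :=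
    fun t ht x => mul_nonneg (h.pos x t (hsub ht)).le (sq_nonneg _)
  let G : ℕ → ℝ → ℝ := fun n t => ∫ x, ψ (n + 1) x * derivTime u x t
  have hG : ∀ n : ℕ, ∀ t ∈ Icc t₀ t₁, G n t =
      ∫ x, (p * (ψ₂ (n + 1) x * (u x t * derivSpace (lnpOf p u) x t ^ 2)) -
        ψ₄ (n + 1) x * ((u x t ^ (p - 1)) ^ 2 * u x t) / (2 * p - 1)) := fun n t ht => by
    obtain ⟨-, ⟨d₁, d₂, d₃, d₄, c₄⟩, ⟨z, z₁, z₂, z₃, z₄⟩, -⟩ := hψ _ (hn n)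
    rw [← (h.isProfile (hsub ht)).integral_test_eq d₁ d₂ d₃ d₄ c₄ z z₁ z₂ z₃ z₄]
    exact integral_congr_ae (.of_forall fun x => by simp only [h.pde x t (hsub ht)])
  have hGc : ∀ n : ℕ, ContinuousOn (G n) (Icc t₀ t₁) := fun n => by
    obtain ⟨-, ⟨d₁, -⟩, ⟨z, -⟩, -⟩ := hψ _ (hn n)
    exact (h.smooth.timeDeriv.continuousOn_integral_mul (continuous_of_hasDerivAt d₁) z).mono hsub
  have hi₄ : ∀ n : ℕ, ∀ t ∈ Icc t₀ t₁, ∀ x, |ψ₄ (n + 1) x *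
      ((u x t ^ (p - 1)) ^ 2 * u x t) / (2 * p - 1)| ≤
        B * (M ^ (p - 1)) ^ 2 * (1 / ((n : ℝ) + 1)) * u x t := fun n t ht x => by
    obtain ⟨-, -, -, -, -, b₄⟩ := hψ _ (hn n)
    have h0 := h.pos x t (hsub ht)
    have h2 : (1 : ℝ) ≤ 2 * p - 1 := by linarith
    rw [abs_div, abs_mul, abs_of_pos (by linarith : 0 < 2 * p - 1),
      abs_of_nonneg (by positivity : 0 ≤ (u x t ^ (p - 1)) ^ 2 * u x t)]
    refine (div_le_self (by positivity) h2).trans ?_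
    have h3 : |ψ₄ (n + 1) x| ≤ B / (n + 1) :=
      (b₄ x).trans (div_le_div_of_nonneg_left hB (by linarith [hn n])
        (le_self_pow₀ (hn n) two_ne_zero))
    have h4 := hrM t ht x
    calc _ ≤ B / (n + 1) * ((M ^ (p - 1)) ^ 2 * u x t) := by gcongr
      _ = _ := by ring
  have hi₂ : ∀ n : ℕ, ∀ t ∈ Icc t₀ t₁, Integrable fun x =>
      ψ₂ (n + 1) x * (u x t * derivSpace (lnpOf p u) x t ^ 2) := fun n t ht => by
    obtain ⟨-, ⟨-, -, d₃, -⟩, -, -, b₂, -⟩ := hψ _ (hn n)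
    exact (h.integrable_fisher t (hsub ht)).bdd_mul
      (continuous_of_hasDerivAt d₃).aestronglyMeasurable (.of_forall b₂)
  have hi₄' : ∀ n : ℕ, ∀ t ∈ Icc t₀ t₁, Integrable fun x => ψ₄ (n + 1) x *
      ((u x t ^ (p - 1)) ^ 2 * u x t) / (2 * p - 1) := fun n t ht => by
    obtain ⟨-, ⟨-, -, -, -, c₄⟩, -⟩ := hψ _ (hn n)
    have hc := (h.isProfile (hsub ht)).continuous_r
    have hc' := (h.isProfile (hsub ht)).continuous_u
    exact ((h.integrable t (hsub ht)).const_mul _).mono'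
      (by fun_prop : Continuous fun x => ψ₄ (n + 1) x *
      ((u x t ^ (p - 1)) ^ 2 * u x t) / (2 * p - 1)).aestronglyMeasurable
      (.of_forall (hi₄ n t ht))
  have hsplit : ∀ n : ℕ, ∀ t ∈ Icc t₀ t₁, G n t =
      p * (∫ x, ψ₂ (n + 1) x * (u x t * derivSpace (lnpOf p u) x t ^ 2)) -
        ∫ x, ψ₄ (n + 1) x * ((u x t ^ (p - 1)) ^ 2 * u x t) / (2 * p - 1) := fun n t ht => by
    rw [hG n t ht, integral_sub ((hi₂ n t ht).const_mul p) (hi₄' n t ht), integral_const_mul]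
  have habs₄ : ∀ n : ℕ, ∀ t ∈ Icc t₀ t₁,
      |∫ x, ψ₄ (n + 1) x * ((u x t ^ (p - 1)) ^ 2 * u x t) / (2 * p - 1)| ≤
        B * (M ^ (p - 1)) ^ 2 * (1 / ((n : ℝ) + 1)) := fun n t ht => by
    rw [← Real.norm_eq_abs]
    refine (norm_integral_le_of_norm_le ((h.integrable t (hsub ht)).const_mul _)
      (.of_forall (hi₄ n t ht))).trans (le_of_eq ?_)
    rw [integral_const_mul, h.integral_eq_one t (hsub ht), mul_one]
  have hlim : ∀ t ∈ Icc t₀ t₁, Tendsto (fun n => G n t) atTop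
      (nhds (2 * p * ∫ x, u x t * derivSpace (lnpOf p u) x t ^ 2)) := fun t ht => by
    have l₂ := (tendsto_integral_mul_of_eq_one (φ := ψ₂) (B := B)
      (fun R hR => continuous_of_hasDerivAt (hψ R hR).2.1.2.2.1)
      (fun R hR => (hψ R hR).2.2.2.2.1) (fun R hR => (hψ R hR).2.2.2.1)
      (h.integrable_fisher t (hsub ht))).const_mul p
    have l₄ : Tendsto (fun n : ℕ =>
        ∫ x, ψ₄ (n + 1) x * ((u x t ^ (p - 1)) ^ 2 * u x t) / (2 * p - 1)) atTop (nhds 0) := by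
      refine squeeze_zero_norm (fun n => habs₄ n t ht) ?_
      have := (tendsto_one_div_add_atTop_nhds_zero_nat (𝕜 := ℝ)).const_mul
        (B * (M ^ (p - 1)) ^ 2)
      rwa [mul_zero] at this
    refine ((l₂.sub l₄).congr fun n => (hsplit n t ht).symm).trans_eq ?_
    rw [integral_const_mul, sub_zero]
    congr 1
    ring
  have hbound : ∀ n : ℕ, ∀ t ∈ Icc t₀ t₁, ‖G n t‖ ≤ p * (B * N) + B * (M ^ (p - 1)) ^ 2 :=
    fun n t ht => by
    obtain ⟨-, -, -, -, b₂, -⟩ := hψ _ (hn n)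
    have h₂ : |∫ x, ψ₂ (n + 1) x * (u x t * derivSpace (lnpOf p u) x t ^ 2)| ≤ B * N := by
      rw [← Real.norm_eq_abs]
      refine (norm_integral_le_of_norm_le ((h.integrable_fisher t (hsub ht)).const_mul B)
        (.of_forall fun x => ?_)).trans ?_
      · rw [norm_mul, Real.norm_of_nonneg (fisher_nonneg t ht x)]
        exact mul_le_mul_of_nonneg_right (b₂ x) (fisher_nonneg t ht x)
      · rw [integral_const_mul]
        exact mul_le_mul_of_nonneg_left (hN t ht) hB
    have h₄ : B * (M ^ (p - 1)) ^ 2 * (1 / ((n : ℝ) + 1)) ≤ B * (M ^ (p - 1)) ^ 2 :=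
      mul_le_of_le_one_right (by positivity) ((div_le_one (by linarith [hn n])).2 (hn n))
    rw [hsplit n t ht]
    refine (norm_sub_le _ _).trans (add_le_add ?_ ((habs₄ n t ht).trans h₄))
    rw [norm_mul, Real.norm_of_nonneg (by linarith)]
    exact mul_le_mul_of_nonneg_left h₂ (by linarith)
  have huIoc : uIoc t₀ t₁ ⊆ Icc t₀ t₁ := by rw [uIoc_of_le h01]; exact Ioc_subset_Icc_self
  have hmeas : ∀ n : ℕ, AEStronglyMeasurable (G n) (volume.restrict (uIoc t₀ t₁)) := fun n =>
    ((hGc n).mono huIoc).aestronglyMeasurable measurableSet_uIoc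
  have hae : ∀ᵐ t ∂volume.restrict (uIoc t₀ t₁), Tendsto (fun n => G n t) atTop
      (nhds (2 * p * ∫ x, u x t * derivSpace (lnpOf p u) x t ^ 2)) :=
    (ae_restrict_iff' measurableSet_uIoc).2 (.of_forall fun t ht => hlim t (huIoc ht))
  have hconst : IntervalIntegrable (fun _ => p * (B * N) + B * (M ^ (p - 1)) ^ 2) volume t₀ t₁ :=
    intervalIntegrable_const
  refine ⟨?_, ?_⟩
  · refine IntervalIntegrable.mono_fun (intervalIntegrable_const (c := 2 * p * N))
      (aestronglyMeasurable_of_tendsto_ae atTop hmeas hae)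
      ((ae_restrict_iff' measurableSet_uIoc).2 (.of_forall fun t ht => ?_))
    have h1 : 0 ≤ ∫ x, u x t * derivSpace (lnpOf p u) x t ^ 2 :=
      integral_nonneg (fisher_nonneg t (huIoc ht))
    have h2 := hN t (huIoc ht)
    change ‖2 * p * ∫ x, u x t * derivSpace (lnpOf p u) x t ^ 2‖ ≤ ‖2 * p * N‖
    rw [Real.norm_of_nonneg (mul_nonneg (by linarith) h1)]
    exact (mul_le_mul_of_nonneg_left h2 (by linarith)).trans (Real.le_norm_self _)
  · have hftc : ∀ n : ℕ, ∫ t in t₀..t₁, G n t =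
        (∫ x, ψ (n + 1) x * u x t₁) - ∫ x, ψ (n + 1) x * u x t₀ := fun n => by
      obtain ⟨-, ⟨d₁, -⟩, ⟨z, -⟩, -⟩ := hψ _ (hn n)
      refine intervalIntegral.integral_eq_sub_of_hasDerivAt
        (f := fun t => ∫ x, ψ (n + 1) x * u x t) (fun t ht => ?_)
        ((uIcc_of_le h01 ▸ hGc n).intervalIntegrable)
      rw [uIcc_of_le h01] at ht
      exact h.smooth.hasDerivAt_integral_mul (continuous_of_hasDerivAt d₁) z (hsub ht)
    have hmom : ∀ t ∈ Icc t₀ t₁, Tendsto (fun n : ℕ => ∫ x, ψ (n + 1) x * u x t) atTop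
        (nhds (∫ x, x ^ 2 * u x t)) := fun t ht => by
      have := tendsto_integral_mul_of_eq_one (φ := χ) (B := 1) (fun R hR => (hψ R hR).1.1)
        (fun R hR => (hψ R hR).1.2.1) (fun R hR => (hψ R hR).1.2.2.1)
        (h.integrable_moment t (hsub ht))
      simp only [one_mul] at this
      refine this.congr fun n => integral_congr_ae (.of_forall fun x => ?_)
      simp only [(hψ _ (hn n)).1.2.2.2 x, mul_assoc]
    refine tendsto_nhds_unique ((hmom t₁ (right_mem_Icc.2 h01)).sub
      (hmom t₀ (left_mem_Icc.2 h01))) ?_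
    simp only [← hftc]
    exact intervalIntegral.tendsto_integral_filter_of_dominated_convergence _
      (.of_forall hmeas) (.of_forall fun n => .of_forall fun t ht => hbound n t (huIoc ht)) hconst
      (.of_forall fun t ht => hlim t (huIoc ht))

end IsSolution

namespace IsSolution

variable {p T : ℝ} {u : ℝ → ℝ → ℝ}

/-- The Fisher information is a limit from below of continuous functions of time. -/
theorem exists_continuousOn_tendsto_fisher (h : IsSolution p T u) :
    ∃ G : ℕ → ℝ → ℝ, (∀ n, ContinuousOn (G n) (Ioo 0 T)) ∧ ∀ t ∈ Ioo 0 T,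
      (∀ n, G n t ≤ ∫ x, u x t * derivSpace (lnpOf p u) x t ^ 2) ∧
      Tendsto (fun n => G n t) atTop (nhds (∫ x, u x t * derivSpace (lnpOf p u) x t ^ 2)) := by
  obtain ⟨B, hB1, χ, χ₁, χ₂, hχ⟩ := exists_cutoffs
  have hn : ∀ n : ℕ, (1 : ℝ) ≤ n + 1 := fun n => by simp
  have habs : ∀ R, 1 ≤ R → ∀ x, |χ R x| ≤ 1 := fun R hR x => by
    rw [abs_of_nonneg ((hχ R hR).1.nonneg x)]
    exact (hχ R hR).1.le_one x
  refine ⟨fun n t => ∫ x, χ (n + 1) x * (u x t * derivSpace (lnpOf p u) x t ^ 2),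
    fun n => ?_, fun t ht => ⟨fun n => ?_, ?_⟩⟩
  · exact (h.smooth.mul (h.smooth_lnpOf.spaceDeriv.pow 2)).continuousOn_integral_mul
      (hχ _ (hn n)).1.continuous (hχ _ (hn n)).1.zero
  · have hf : ∀ x, 0 ≤ u x t * derivSpace (lnpOf p u) x t ^ 2 := fun x =>
      mul_nonneg (h.pos x t ht).le (sq_nonneg _)
    exact integral_mono_of_nonneg (.of_forall fun x =>
      mul_nonneg ((hχ _ (hn n)).1.nonneg x) (hf x)) (h.integrable_fisher t ht)
      (.of_forall fun x => mul_le_of_le_one_left (hf x) ((hχ _ (hn n)).1.le_one x))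
  · simpa only [one_mul] using tendsto_integral_mul_of_eq_one (B := 1) (c := 1)
      (fun R hR => (hχ R hR).1.continuous) habs
      (fun R hR x hx => (hχ R hR).2.2.2 x hx.le) (h.integrable_fisher t ht)

/-- By Baire's theorem, every time interval contains a subinterval on which the Fisher information
is bounded. -/
theorem exists_fisher_le_on_Icc (h : IsSolution p T u) {a b : ℝ} (ha : a ∈ Ioo 0 T)
    (hb : b ∈ Ioo 0 T) (hab : a < b) : ∃ c d N, a < c ∧ c < d ∧ d < b ∧
      ∀ t ∈ Icc c d, ∫ x, u x t * derivSpace (lnpOf p u) x t ^ 2 ≤ N := by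
  have hsub : Icc a b ⊆ Ioo 0 T := fun t ht => ⟨ha.1.trans_le ht.1, ht.2.trans_lt hb.2⟩
  obtain ⟨G, hGc, hG⟩ := h.exists_continuousOn_tendsto_fisher
  let E : ℕ → Set ℝ := fun N => (Iic a ∪ Ici b) ∪ ⋂ n, Icc a b ∩ G n ⁻¹' Iic (N : ℝ)
  have hclosed : ∀ N, IsClosed (E N) := fun N =>
    (isClosed_Iic.union isClosed_Ici).union (isClosed_iInter fun n =>
      ((hGc n).mono hsub).preimage_isClosed_of_isClosed isClosed_Icc isClosed_Iic)
  have huniv : ⋃ N, E N = univ := eq_univ_of_forall fun t => by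
    by_cases ht : t ∈ Icc a b
    · obtain ⟨N, hN⟩ := exists_nat_ge (∫ x, u x t * derivSpace (lnpOf p u) x t ^ 2)
      exact mem_iUnion.2 ⟨N, .inr (mem_iInter.2 fun n => ⟨ht, ((hG t (hsub ht)).1 n).trans hN⟩)⟩
    · refine mem_iUnion.2 ⟨0, .inl ?_⟩
      by_cases h1 : t ≤ a
      · exact .inl h1
      · exact .inr (not_lt.1 fun h2 => ht ⟨(not_le.1 h1).le, h2.le⟩)
  obtain ⟨t, ht, hti⟩ := (dense_iUnion_interior_of_closed hclosed huniv).exists_mem_open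
    isOpen_Ioo (nonempty_Ioo.2 hab)
  obtain ⟨N, hN⟩ := mem_iUnion.1 ht
  obtain ⟨ε, hε, hball⟩ := Metric.isOpen_iff.1 (isOpen_interior.inter isOpen_Ioo) t ⟨hN, hti⟩
  have hmem : Icc (t - ε / 2) (t + ε / 2) ⊆ E N ∩ Ioo a b := fun r hr => by
    have := hball (show r ∈ Metric.ball t ε by
      rw [Metric.mem_ball, Real.dist_eq, abs_lt]
      constructor <;> linarith [hr.1, hr.2])
    exact ⟨interior_subset this.1, this.2⟩
  refine ⟨t - ε / 2, t + ε / 2, N, (hmem (left_mem_Icc.2 (by linarith))).2.1, by linarith,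
    (hmem (right_mem_Icc.2 (by linarith))).2.2, fun r hr => ?_⟩
  obtain ⟨(h1 | h1) | h1, h2⟩ := hmem hr
  · exact absurd h2.1 (not_lt.2 h1)
  · exact absurd h2.2 (not_lt.2 h1)
  · exact le_of_tendsto' (hG r (hsub (Ioo_subset_Icc_self h2))).2 fun n => (mem_iInter.1 h1 n).2

/-- If the second moment is continuously differentiable, its derivative dominates the Fisher
information. -/
theorem fisher_le_deriv_moment (h : IsSolution p T u) {Θ' : ℝ → ℝ}
    (hd : ∀ t ∈ Ioo 0 T, HasDerivAt (fun t => ∫ x, x ^ 2 * u x t) (Θ' t) t)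
    (hc : ContinuousOn Θ' (Ioo 0 T)) {t : ℝ} (ht : t ∈ Ioo 0 T) :
    2 * p * ∫ x, u x t * derivSpace (lnpOf p u) x t ^ 2 ≤ Θ' t := by
  have hp := h.one_le
  obtain ⟨G, hGc, hG⟩ := h.exists_continuousOn_tendsto_fisher
  refine le_of_tendsto' ((hG t ht).2.const_mul (2 * p)) fun m => not_lt.1 fun hlt => ?_
  have hGm : ContinuousOn (fun t => 2 * p * G m t) (Ioo 0 T) := (hGc m).const_mul _
  obtain ⟨ε, hε, hball⟩ := Metric.eventually_nhds_iff.1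
    (((hc.continuousAt (isOpen_Ioo.mem_nhds ht)).eventually_lt
      (hGm.continuousAt (isOpen_Ioo.mem_nhds ht)) hlt).and (isOpen_Ioo.mem_nhds ht))
  have hmem : ∀ r ∈ Icc (t - ε / 2) (t + ε / 2), Θ' r < 2 * p * G m r ∧ r ∈ Ioo 0 T := fun r hr =>
    hball (by
      rw [Real.dist_eq, abs_lt]
      constructor <;> linarith [hr.1, hr.2])
  obtain ⟨c, d, N, hac, hcd, hdb, hN⟩ := h.exists_fisher_le_on_Icc
    (hmem _ (left_mem_Icc.2 (by linarith))).2 (hmem _ (right_mem_Icc.2 (by linarith))).2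
    (by linarith)
  have hmem' : ∀ r ∈ Icc c d, Θ' r < 2 * p * G m r ∧ r ∈ Ioo 0 T := fun r hr =>
    hmem r ⟨hac.le.trans hr.1, hr.2.trans hdb.le⟩
  have hsub : Icc c d ⊆ Ioo 0 T := fun r hr => (hmem' r hr).2
  obtain ⟨hi, heq⟩ := h.moment_sub_eq (hsub (left_mem_Icc.2 hcd.le))
    (hsub (right_mem_Icc.2 hcd.le)) hcd.le hN
  have hftc : ∫ r in c..d, Θ' r = (∫ x, x ^ 2 * u x d) - ∫ x, x ^ 2 * u x c :=
    intervalIntegral.integral_eq_sub_of_hasDerivAt (f := fun t => ∫ x, x ^ 2 * u x t)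
      (fun r hr => hd r (hsub (uIcc_of_le hcd.le ▸ hr)))
      ((uIcc_of_le hcd.le ▸ hc.mono hsub).intervalIntegrable)
  have h1 : ∫ r in c..d, Θ' r < ∫ r in c..d, 2 * p * G m r :=
    intervalIntegral.integral_lt_integral_of_continuousOn_of_le_of_exists_lt hcd (hc.mono hsub)
      (hGm.mono hsub) (fun r hr => (hmem' r (Ioc_subset_Icc_self hr)).1.le)
      ⟨c, left_mem_Icc.2 hcd.le, (hmem' c (left_mem_Icc.2 hcd.le)).1⟩
  have h2 : ∫ r in c..d, 2 * p * G m r ≤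
      ∫ r in c..d, 2 * p * ∫ x, u x r * derivSpace (lnpOf p u) x r ^ 2 :=
    intervalIntegral.integral_mono_on hcd.le
      ((uIcc_of_le hcd.le ▸ hGm.mono hsub).intervalIntegrable) hi fun r hr =>
      mul_le_mul_of_nonneg_left ((hG r (hsub hr)).1 m) (by linarith)
  linarith

/-- The derivative of the second moment is a multiple of the Fisher information. -/
theorem deriv_moment_eq (h : IsSolution p T u) {Θ' : ℝ → ℝ}
    (hd : ∀ t ∈ Ioo 0 T, HasDerivAt (fun t => ∫ x, x ^ 2 * u x t) (Θ' t) t)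
    (hc : ContinuousOn Θ' (Ioo 0 T)) {t : ℝ} (ht : t ∈ Ioo 0 T) :
    Θ' t = 2 * p * ∫ x, u x t * derivSpace (lnpOf p u) x t ^ 2 := by
  have hp := h.one_le
  refine le_antisymm (not_lt.1 fun hlt => ?_) (h.fisher_le_deriv_moment hd hc ht)
  obtain ⟨ε, hε, hball⟩ := Metric.eventually_nhds_iff.1
    (((hc.continuousAt (isOpen_Ioo.mem_nhds ht)).eventually (lt_mem_nhds hlt)).and
      (isOpen_Ioo.mem_nhds ht))
  obtain ⟨d, hd_eq⟩ : ∃ d, d = t + ε / 2 := ⟨_, rfl⟩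
  have htd : t < d := by linarith
  have hmem : ∀ r ∈ Icc t d, _ := fun r hr => @hball r (by
    rw [Real.dist_eq, abs_lt]
    constructor <;> linarith [hr.1, hr.2])
  have hsub : Icc t d ⊆ Ioo 0 T := fun r hr => (hmem r hr).2
  obtain ⟨C, hC⟩ := isCompact_Icc.exists_bound_of_continuousOn (hc.mono hsub)
  have hbd : ∀ r ∈ Icc t d, ∫ x, u x r * derivSpace (lnpOf p u) x r ^ 2 ≤ C := fun r hr => by
    have h0 : 0 ≤ ∫ x, u x r * derivSpace (lnpOf p u) x r ^ 2 :=
      integral_nonneg fun x => mul_nonneg (h.pos x r (hsub hr)).le (sq_nonneg _)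
    have h1 := h.fisher_le_deriv_moment hd hc (hsub hr)
    have h2 := (le_abs_self _).trans (hC r hr)
    nlinarith
  have hmono : ∀ r ∈ Icc t d, ∫ x, u x r * derivSpace (lnpOf p u) x r ^ 2 ≤
      ∫ x, u x t * derivSpace (lnpOf p u) x t ^ 2 := fun r hr =>
    h.fisher_le_of_bounded ht (hsub hr) hr.1 fun q hq => hbd q ⟨hq.1, hq.2.trans hr.2⟩
  obtain ⟨hi, heq⟩ := h.moment_sub_eq ht (hsub (right_mem_Icc.2 htd.le)) htd.le hmono
  have hftc : ∫ r in t..d, Θ' r = (∫ x, x ^ 2 * u x d) - ∫ x, x ^ 2 * u x t :=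
    intervalIntegral.integral_eq_sub_of_hasDerivAt (f := fun t => ∫ x, x ^ 2 * u x t)
      (fun r hr => hd r (hsub (uIcc_of_le htd.le ▸ hr)))
      ((uIcc_of_le htd.le ▸ hc.mono hsub).intervalIntegrable)
  have h1 : ∫ _ in t..d, (2 * p * ∫ x, u x t * derivSpace (lnpOf p u) x t ^ 2) <
      ∫ r in t..d, Θ' r :=
    intervalIntegral.integral_lt_integral_of_continuousOn_of_le_of_exists_lt htd
      continuousOn_const (hc.mono hsub) (fun r hr => (hmem r (Ioc_subset_Icc_self hr)).1.le)
      ⟨t, left_mem_Icc.2 htd.le, hlt⟩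
  have h2 : ∫ r in t..d, 2 * p * ∫ x, u x r * derivSpace (lnpOf p u) x r ^ 2 ≤
      ∫ _ in t..d, (2 * p * ∫ x, u x t * derivSpace (lnpOf p u) x t ^ 2) :=
    intervalIntegral.integral_mono_on htd.le hi intervalIntegrable_const fun r hr =>
      mul_le_mul_of_nonneg_left (hmono r hr) (by linarith)
  linarith

end IsSolution

theorem lnp_mul (p : ℝ) {σ w : ℝ} (hσ : 0 < σ) (hw : 0 < w) :
    lnp p (σ * w) = σ ^ (p - 1) * lnp p w + lnp p σ := by
  unfold lnp
  split_ifs with h1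
  · rw [Real.log_mul hσ.ne' hw.ne', h1, sub_self, Real.rpow_zero, one_mul, add_comm]
  · rw [Real.mul_rpow hσ.le hw.le]
    ring

theorem deriv_const_mul_comp_mul_left (c σ : ℝ) (f : ℝ → ℝ) :
    deriv (fun x => c * f (σ * x)) = fun x => c * σ * deriv f (σ * x) := by
  ext x
  rw [deriv_const_mul_field, deriv_comp_mul_left, smul_eq_mul, mul_assoc]

section Dilation

variable {p σ : ℝ} {f : ℝ → ℝ}

theorem deriv_lnp_dilation (hσ : 0 < σ) (hf : ∀ x, 0 < f x) :
    deriv (fun x => lnp p (σ * f (σ * x))) =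
      fun x => σ ^ p * deriv (fun x => lnp p (f x)) (σ * x) := by
  have h1 : (fun x => lnp p (σ * f (σ * x))) =
      fun x => σ ^ (p - 1) * lnp p (f (σ * x)) + lnp p σ := by
    ext x
    exact lnp_mul p hσ (hf _)
  have h2 : σ ^ (p - 1) * σ = σ ^ p := by
    rw [Real.rpow_sub_one hσ.ne', div_mul_cancel₀ _ hσ.ne']
  rw [h1]
  ext x
  rw [deriv_add_const, deriv_const_mul_comp_mul_left _ _ fun x => lnp p (f x), h2]

theorem fisherP_dilation (hσ : 0 < σ) (hf : ∀ x, 0 < f x) :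
    fisherP p (fun x => σ * f (σ * x)) = (σ ^ p) ^ 2 * fisherP p f := by
  obtain ⟨g, hg⟩ : ∃ g, g = fun x => f x * deriv (fun x => lnp p (f x)) x ^ 2 := ⟨_, rfl⟩
  have h1 : ∀ x, σ * f (σ * x) * (σ ^ p * deriv (fun x => lnp p (f x)) (σ * x)) ^ 2 =
      σ * (σ ^ p) ^ 2 * g (σ * x) := fun x => by
    rw [hg]
    ring
  simp only [fisherP, deriv_lnp_dilation hσ hf]
  simp only [h1]
  rw [integral_const_mul, Measure.integral_comp_mul_left, abs_of_pos (inv_pos.2 hσ), smul_eq_mul,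
    ← hg]
  field_simp

theorem deriv_deriv_flux_dilation (hσ : 0 < σ) (hf : ∀ x, 0 < f x) (y : ℝ) :
    deriv (deriv fun x => (σ * f (σ * x)) ^ p *
      deriv (deriv fun x => lnp p (σ * f (σ * x))) x) y =
    (σ ^ p) ^ 2 * σ ^ 3 *
      deriv (deriv fun x => f x ^ p * deriv (deriv fun x => lnp p (f x)) x) (σ * y) := by
  obtain ⟨Q, hQ⟩ : ∃ Q, Q = fun x => f x ^ p * deriv (deriv fun x => lnp p (f x)) x := ⟨_, rfl⟩
  have h1 : (fun x => (σ * f (σ * x)) ^ p * deriv (deriv fun x => lnp p (σ * f (σ * x))) x) =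
      fun x => (σ ^ p) ^ 2 * σ * Q (σ * x) := by
    ext x
    rw [deriv_lnp_dilation hσ hf, deriv_const_mul_comp_mul_left, Real.mul_rpow hσ.le (hf _).le, hQ]
    ring
  rw [h1, deriv_const_mul_comp_mul_left, deriv_const_mul_comp_mul_left, ← hQ]
  ring

end Dilation

/-- The inverse of a strictly increasing function between open intervals has the reciprocal
derivative. -/
theorem hasDerivAt_inverse_of_strictMonoOn {T T' d r : ℝ} {τ tinv : ℝ → ℝ}
    (hmono : StrictMonoOn τ (Ioo 0 T)) (honto : τ '' Ioo 0 T = Ioo 0 T')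
    (h₁ : ∀ t ∈ Ioo 0 T, tinv (τ t) = t)
    (h₂ : ∀ r ∈ Ioo 0 T', tinv r ∈ Ioo 0 T ∧ τ (tinv r) = r) (hr : r ∈ Ioo 0 T')
    (hd : HasDerivAt τ d (tinv r)) (hd0 : d ≠ 0) : HasDerivAt tinv d⁻¹ r := by
  refine HasDerivAt.of_local_left_inverse ?_ hd hd0
    (eventually_of_mem (isOpen_Ioo.mem_nhds hr) fun ρ hρ => (h₂ ρ hρ).2)
  have htm : StrictMonoOn tinv (Ioo 0 T') := fun a ha b hb hab => by
    rw [← hmono.lt_iff_lt (h₂ a ha).1 (h₂ b hb).1, (h₂ a ha).2, (h₂ b hb).2]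
    exact hab
  have himg : tinv '' Ioo 0 T' = Ioo 0 T := by
    rw [← honto, image_image]
    exact (image_congr h₁).trans (image_id' _)
  refine htm.continuousAt_of_image_mem_nhds (isOpen_Ioo.mem_nhds hr) ?_
  rw [himg]
  exact isOpen_Ioo.mem_nhds (h₂ r hr).1

/-- The derivative of `s u(s y, t)` along a curve `(s, t)`. -/
theorem SmoothOnStrip.hasDerivAt_rescaled {T : ℝ} {u : ℝ → ℝ → ℝ} (hu : SmoothOnStrip T u)
    {s τ : ℝ → ℝ} {s' τ' r : ℝ} (y : ℝ) (hs : HasDerivAt s s' r) (hτ : HasDerivAt τ τ' r)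
    (hr : τ r ∈ Ioo 0 T) :
    HasDerivAt (fun ρ => s ρ * u (s ρ * y) (τ ρ))
      (s' * u (s r * y) (τ r) + s r * (s' * y * derivSpace u (s r * y) (τ r) +
        τ' * derivTime u (s r * y) (τ r))) r := by
  have hF := ((hu.contDiffAt (s r * y) hr).differentiableAt (by simp)).hasFDerivAt
  have h1 := HasFDerivAt.comp_hasDerivAt (f := fun ρ => (s ρ * y, τ ρ)) r hF
    ((hs.mul_const y).prodMk hτ)
  have h2 : ((s' * y, τ') : ℝ × ℝ) = (s' * y) • (1, 0) + τ' • (0, 1) := by simp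
  rw [h2, map_add, map_smul, map_smul] at h1
  rw [derivSpace, (hu.hasDerivAt_fderiv_space (s r * y) hr).deriv, derivTime,
    (hu.hasDerivAt_fderiv_time (s r * y) hr).deriv]
  exact hs.mul h1

/-- the time-dependent, second-moment preserving rescaling
`v(y,τ) = s(τ) u(s(τ)y, t(τ))`, `s(τ) = (Θ(t(τ))/Θ₀)^{1/2}`,
`τ(t) = (Θ₀/(4p)) ln(Θ(t)/Θ₀)`, transforms a smooth positive solution of
`∂_t u = −∂_x²(u^p ∂_x²(ln_p u))` into a solution of the nonlocal equation
`∂_τ v = −(1/I_p(v)) ∂_y²(v^p ∂_y²(ln_p v)) + (2p/Θ₀) ∂_y(y v)`. -/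
theorem rescaled_nonlocal_equation
    (p : ℝ) (hp : 1 ≤ p) (T T' : ℝ) (hT : 0 < T) (hT' : 0 < T')
    (u : ℝ → ℝ → ℝ)
    (hsmooth : ContDiffOn ℝ (⊤ : ℕ∞) (Function.uncurry u) (univ ×ˢ Ioo 0 T))
    (hpos : ∀ x t, t ∈ Ioo 0 T → 0 < u x t)
    (hpde : ∀ x t, t ∈ Ioo 0 T →
      deriv (fun s => u x s) t =
        - deriv (deriv (fun z =>
            (u z t) ^ p * deriv (deriv (fun w => lnp p (u w t))) z)) x)
    (hdens : ∀ t ∈ Ioo 0 T,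
      Integrable (fun x => u x t) ∧ (∫ x : ℝ, u x t) = 1)
    (hdecay : ∀ t ∈ Ioo 0 T, RapidDecay (fun x => u x t))
    (Θ : ℝ → ℝ) (hΘ : ∀ t ∈ Ioo 0 T, Θ t = ∫ x : ℝ, x ^ 2 * u x t)
    (hmom : ∀ t ∈ Ioo 0 T, Integrable (fun x => x ^ 2 * u x t))
    (hΘpos : ∀ t ∈ Ioo 0 T, 0 < Θ t)
    (hIpos : ∀ t ∈ Ioo 0 T, 0 < fisherP p (fun x => u x t))
    (Θ₀ : ℝ) (hΘ₀ : 0 < Θ₀)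
    (hΘ₀lim : Tendsto Θ (nhdsWithin 0 (Ioi 0)) (nhds Θ₀))
    (τ : ℝ → ℝ)
    (hτ : ∀ t ∈ Ioo 0 T, τ t = (Θ₀ / (4 * p)) * Real.log (Θ t / Θ₀))
    (hτC1 : ContDiffOn ℝ 1 τ (Ioo 0 T))
    (hτmono : StrictMonoOn τ (Ioo 0 T))
    (hτonto : τ '' (Ioo 0 T) = Ioo 0 T')
    (tinv : ℝ → ℝ)
    (htinv₁ : ∀ t ∈ Ioo 0 T, tinv (τ t) = t)
    (htinv₂ : ∀ r ∈ Ioo 0 T', tinv r ∈ Ioo 0 T ∧ τ (tinv r) = r)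
    (s : ℝ → ℝ)
    (hs : ∀ r ∈ Ioo 0 T', s r = Real.sqrt (Θ (tinv r) / Θ₀))
    (v : ℝ → ℝ → ℝ)
    (hv : ∀ y r, v y r = s r * u (s r * y) (tinv r)) :
    ∀ y r, r ∈ Ioo 0 T' →
      deriv (fun ρ => v y ρ) r =
        -(1 / fisherP p (fun z => v z r)) *
            deriv (deriv (fun z =>
              (v z r) ^ p * deriv (deriv (fun w => lnp p (v w r))) z)) y
        + (2 * p / Θ₀) * deriv (fun z => z * v z r) y := by
  have hp0 : 0 < p := by linarith
  have hsol : IsSolution p T u :=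
    { one_le := hp
      smooth := hsmooth
      pos := hpos
      pde := hpde
      integrable := fun t ht => (hdens t ht).1
      integral_eq_one := fun t ht => (hdens t ht).2
      tendsto_atBot := fun t ht => by
        simpa using (hdecay t ht 0 0).mono_left atBot_le_cocompact
      integrable_moment := hmom
      integrable_fisher := fun t ht => not_imp_comm.1 integral_undef fun h0 =>
        (hIpos t ht).ne' ((congrArg (1 / 2 * ·) h0).trans (mul_zero _)) }
  have hτd : ∀ t ∈ Ioo 0 T, HasDerivAt τ (deriv τ t) t := fun t ht =>
    ((hτC1.contDiffAt (isOpen_Ioo.mem_nhds ht)).differentiableAt one_ne_zero).hasDerivAt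
  have hΘexp : ∀ t ∈ Ioo 0 T, Θ t = Θ₀ * Real.exp (4 * p / Θ₀ * τ t) := fun t ht => by
    rw [hτ t ht, show 4 * p / Θ₀ * (Θ₀ / (4 * p) * Real.log (Θ t / Θ₀)) = Real.log (Θ t / Θ₀) by
      field_simp, Real.exp_log (div_pos (hΘpos t ht) hΘ₀)]
    field_simp
  have hΘd : ∀ t ∈ Ioo 0 T, HasDerivAt (fun t => ∫ x, x ^ 2 * u x t)
      (Θ₀ * (Real.exp (4 * p / Θ₀ * τ t) * (4 * p / Θ₀ * deriv τ t))) t := fun t ht => by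
    refine (((hτd t ht).const_mul (4 * p / Θ₀)).exp.const_mul Θ₀).congr_of_eventuallyEq ?_
    filter_upwards [isOpen_Ioo.mem_nhds ht] with r hr
    rw [← hΘ r hr, hΘexp r hr]
  have hΘc : ContinuousOn
      (fun t => Θ₀ * (Real.exp (4 * p / Θ₀ * τ t) * (4 * p / Θ₀ * deriv τ t))) (Ioo 0 T) :=
    continuousOn_const.mul ((Real.continuous_exp.comp_continuousOn
      (continuousOn_const.mul hτC1.continuousOn)).mul
      (continuousOn_const.mul (hτC1.continuousOn_deriv_of_isOpen isOpen_Ioo le_rfl)))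
  have hτ' : ∀ t ∈ Ioo 0 T, deriv τ t = Θ₀ * fisherP p (fun x => u x t) / Θ t := fun t ht => by
    have h1 := hsol.deriv_moment_eq hΘd hΘc ht
    have h2 : 2 * p * ∫ x, u x t * derivSpace (lnpOf p u) x t ^ 2 =
        4 * p * fisherP p (fun x => u x t) := by
      unfold fisherP derivSpace lnpOf
      ring
    rw [h2, ← mul_assoc, ← hΘexp t ht] at h1
    have := (hΘpos t ht).ne'
    field_simp at h1 ⊢
    linarith
  have hs' : ∀ ρ ∈ Ioo 0 T', s ρ = Real.exp (2 * p / Θ₀ * ρ) := fun ρ hρ => by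
    rw [hs ρ hρ, hΘexp _ (htinv₂ ρ hρ).1, (htinv₂ ρ hρ).2, mul_div_cancel_left₀ _ hΘ₀.ne',
      ← Real.exp_half]
    congr 1
    ring
  intro y r hr
  have ht := (htinv₂ r hr).1
  have hI := hIpos _ ht
  have hσ : 0 < s r := by rw [hs' r hr]; exact Real.exp_pos _
  have hσ2 : s r ^ 2 = Θ (tinv r) / Θ₀ := by
    rw [hs r hr, Real.sq_sqrt (div_pos (hΘpos _ ht) hΘ₀).le]
  have hτt := hτ' _ ht
  have hτpos : 0 < deriv τ (tinv r) := by
    rw [hτt]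
    exact div_pos (mul_pos hΘ₀ hI) (hΘpos _ ht)
  have hds : HasDerivAt s (2 * p / Θ₀ * s r) r := by
    have h1 : HasDerivAt (fun ρ => Real.exp (2 * p / Θ₀ * ρ)) (2 * p / Θ₀ * s r) r := by
      refine ((hasDerivAt_id r).const_mul (2 * p / Θ₀)).exp.congr_deriv ?_
      rw [hs' r hr, id]
      ring
    exact h1.congr_of_eventuallyEq (eventually_of_mem (isOpen_Ioo.mem_nhds hr) hs')
  have hdt := hasDerivAt_inverse_of_strictMonoOn hτmono hτonto htinv₁ htinv₂ hr (hτd _ ht)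
    hτpos.ne'
  have hdv := (hsol.smooth.hasDerivAt_rescaled y hds hdt ht).deriv
  have hv' : v = fun y r => s r * u (s r * y) (tinv r) := by
    ext y r
    exact hv y r
  have hdy : HasDerivAt (fun z => z * (s r * u (s r * z) (tinv r)))
      (1 * (s r * u (s r * y) (tinv r)) +
        y * (s r * (derivSpace u (s r * y) (tinv r) * (s r * 1)))) y :=
    (hasDerivAt_id y).mul (((hsol.smooth.hasDerivAt_space (s r * y) ht).comp y
      ((hasDerivAt_id y).const_mul (s r))).const_mul (s r))
  have hu : ∀ x, 0 < u x (tinv r) := fun x => hpos x _ ht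
  have hpde' := hpde (s r * y) _ ht
  subst hv'
  simp only []
  rw [hdv, hdy.deriv, deriv_deriv_flux_dilation hσ hu, fisherP_dilation hσ hu, derivTime, hpde',
    hτt]
  have hσp := (Real.rpow_pos_of_pos hσ p).ne'
  have hΘ2 : Θ (tinv r) = s r ^ 2 * Θ₀ := by rw [hσ2, div_mul_cancel₀ _ hΘ₀.ne']
  rw [hΘ2]
  have := hI.ne'
  field_simp
  ring
end

section
/- Let p > 1 and let f be a probability density on ℝ that is C^∞, strictly positive, decays together with all its derivatives faster than any polynomial as |x| → ∞, and has finite second moment Θ₀ = ∫_ℝ x² f dx > 0. Let B be the Barenblatt profile of unit mass and second moment Θ₀. Then exp( (p+1) ( R_p(B) − R_p(f) ) ) ≤ J_p(f) / J_p(B), where J_p(g) = (∫_ℝ g^p dx)^{-1} ∫_{{g>0}} ( d/dx (g^p) )² / g dx is the modified Fisher information. -/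
open MeasureTheory Filter Set

/-- Modified Fisher information `J_p(g) = (∫ g^p)⁻¹ ∫_{g>0} ((g^p)')²/g`. -/
noncomputable def modFisher (p : ℝ) (g : ℝ → ℝ) : ℝ :=
  (∫ x : ℝ, g x ^ p)⁻¹ *
    ∫ x in {x : ℝ | 0 < g x}, (deriv (fun z => g z ^ p) x) ^ 2 / g x

theorem exists_monotone_transport {f B : ℝ → ℝ} {a b : ℝ} (hab : a < b)
    (hf : Continuous f) (hpos : ∀ x, 0 < f x) (hfint : Integrable f) (hfmass : ∫ x, f x = 1)
    (hB : Continuous B) (hBpos : ∀ y ∈ Ioo a b, 0 < B y) (hBmass : ∫ y in a..b, B y = 1) :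
    ∃ T : ℝ → ℝ, Function.Injective T ∧ (∀ x, T x ∈ Ioo a b) ∧
      ∀ x, HasDerivAt T (f x / B (T x)) x := by
  set F : ℝ → ℝ := fun x => ∫ y in Iic x, f y with hF
  set G : ℝ → ℝ := fun t => ∫ y in a..t, B y with hG
  have hFderiv (x : ℝ) : HasDerivAt F (f x) x := by
    have h1 : HasDerivAt (fun u => F 0 + ∫ y in (0 : ℝ)..u, f y) (f x) x :=
      (hf.integral_hasStrictDerivAt 0 x).hasDerivAt.const_add _
    refine h1.congr_of_eventuallyEq (Eventually.of_forall fun u => ?_)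
    have := intervalIntegral.integral_Iic_sub_Iic (a := 0) (b := u)
      hfint.integrableOn hfint.integrableOn
    simp only [hF]
    linarith
  have hGderiv (t : ℝ) : HasDerivAt G (B t) t := (hB.integral_hasStrictDerivAt a t).hasDerivAt
  have hFmono : StrictMono F := strictMono_of_hasDerivAt_pos hFderiv hpos
  have hFmem (x : ℝ) : F x ∈ Ioo 0 1 := by
    refine ⟨lt_of_le_of_lt ?_ (hFmono (sub_one_lt x)), lt_of_lt_of_le (hFmono (lt_add_one x)) ?_⟩
    · exact integral_nonneg fun y => (hpos y).le
    · rw [← hfmass]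
      exact setIntegral_le_integral hfint (Eventually.of_forall fun y => (hpos y).le)
  have hGcont : Continuous G := continuous_iff_continuousAt.2 fun t => (hGderiv t).continuousAt
  have hGmono : StrictMonoOn G (Icc a b) := by
    refine strictMonoOn_of_deriv_pos (convex_Icc a b) hGcont.continuousOn fun t ht => ?_
    rw [interior_Icc] at ht
    rw [(hGderiv t).deriv]
    exact hBpos t ht
  have hsurj : ∀ u ∈ Ioo (0 : ℝ) 1, ∃ t, t ∈ Ioo a b ∧ G t = u := by
    intro u hu
    have h := intermediate_value_Ioo hab.le hGcont.continuousOn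
    have hGa : G a = 0 := by simp [hG]
    have hGb : G b = 1 := hBmass
    rw [hGa, hGb] at h
    exact h hu
  choose! g hg hGg using hsurj
  have hgcont (u : ℝ) (hu : u ∈ Ioo (0 : ℝ) 1) : ContinuousAt g u := by
    have hnhds : ∀ᶠ v in nhds u, v ∈ Ioo (0 : ℝ) 1 := isOpen_Ioo.mem_nhds hu
    refine tendsto_order.2 ⟨fun c hc => ?_, fun c hc => ?_⟩
    · rcases lt_or_ge a c with hac | hac
      · have hcmem : c ∈ Icc a b := ⟨hac.le, hc.le.trans (hg u hu).2.le⟩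
        have hlt : G c < u := hGg u hu ▸ hGmono hcmem (Ioo_subset_Icc_self (hg u hu)) hc
        filter_upwards [hnhds, lt_mem_nhds hlt] with v hv hcv
        rw [← hGg v hv] at hcv
        exact (hGmono.lt_iff_lt hcmem (Ioo_subset_Icc_self (hg v hv))).1 hcv
      · filter_upwards [hnhds] with v hv using hac.trans_lt (hg v hv).1
    · rcases lt_or_ge c b with hcb | hcb
      · have hcmem : c ∈ Icc a b := ⟨(hg u hu).1.le.trans hc.le, hcb.le⟩
        have hlt : u < G c := hGg u hu ▸ hGmono (Ioo_subset_Icc_self (hg u hu)) hcmem hc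
        filter_upwards [hnhds, gt_mem_nhds hlt] with v hv hcv
        rw [← hGg v hv] at hcv
        exact (hGmono.lt_iff_lt (Ioo_subset_Icc_self (hg v hv)) hcmem).1 hcv
      · filter_upwards [hnhds] with v hv using (hg v hv).2.trans_le hcb
  refine ⟨fun x => g (F x), fun x y hxy => ?_, fun x => hg _ (hFmem x), fun x => ?_⟩
  · apply hFmono.injective
    rw [← hGg _ (hFmem x), ← hGg _ (hFmem y)]
    exact congrArg G hxy
  · have hinv : HasDerivAt g (B (g (F x)))⁻¹ (F x) := by
      refine HasDerivAt.of_local_left_inverse (hgcont _ (hFmem x)) (hGderiv _)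
        (hBpos _ (hg _ (hFmem x))).ne' ?_
      filter_upwards [isOpen_Ioo.mem_nhds (hFmem x)] with v hv using hGg v hv
    rw [div_eq_inv_mul]
    exact hinv.comp x (hFderiv x)

theorem integral_comp_transport_le {f B T φ : ℝ → ℝ} {a b : ℝ}
    (hT : Function.Injective T) (hTmem : ∀ x, T x ∈ Ioo a b)
    (hTderiv : ∀ x, HasDerivAt T (f x / B (T x)) x) (hpos : ∀ x, 0 < f x)
    (hBpos : ∀ y ∈ Ioo a b, 0 < B y) (hB : ∀ y, 0 ≤ φ y * B y)
    (hφB : Integrable fun y => φ y * B y) :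
    ∫ x, φ (T x) * f x ≤ ∫ y, φ y * B y := by
  have h := integral_image_eq_integral_abs_deriv_smul MeasurableSet.univ
    (fun x _ => (hTderiv x).hasDerivWithinAt) hT.injOn (fun y => φ y * B y)
  have heq : ∀ x, |f x / B (T x)| • (φ (T x) * B (T x)) = φ (T x) * f x := by
    intro x
    have hb := hBpos _ (hTmem x)
    rw [abs_of_pos (div_pos (hpos x) hb), smul_eq_mul]
    field_simp
  simp only [heq, Measure.restrict_univ] at h
  rw [← h]
  exact setIntegral_le_integral hφB (Eventually.of_forall hB)

theorem exists_bound_of_tendsto_cocompact {g : ℝ → ℝ} (hg : Continuous g)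
    (h0 : Tendsto g (cocompact ℝ) (nhds 0)) : ∃ M, 0 < M ∧ ∀ x, |g x| ≤ M := by
  obtain ⟨M, hM⟩ := (ZeroAtInftyContinuousMap.mk ⟨g, hg⟩ h0).isBounded_range.exists_pos_norm_le
  exact ⟨M, hM.1, fun x => hM.2 _ ⟨x, rfl⟩⟩

theorem integrable_rpow_of_decay {f : ℝ → ℝ} (hf : Continuous f) (hpos : ∀ x, 0 < f x)
    (hdecay : ∀ n : ℕ, Tendsto (fun x => x ^ n * f x) (cocompact ℝ) (nhds 0))
    {s : ℝ} (hs : 0 < s) : Integrable fun x => f x ^ s := by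
  obtain ⟨n, hn⟩ := exists_nat_gt (1 / s)
  have hns : 1 ≤ n * s := by
    rw [div_lt_iff₀ hs] at hn
    exact hn.le
  obtain ⟨M, hM, hfM⟩ := exists_bound_of_tendsto_cocompact hf (by simpa using hdecay 0)
  obtain ⟨L, hL, hfL⟩ := exists_bound_of_tendsto_cocompact (by fun_prop) (hdecay (2 * n))
  set A := 2 ^ (n - 1) * (M + L)
  have hA : 0 < A := by positivity
  have hbound (x : ℝ) : f x ≤ A / (1 + x ^ 2) ^ n := by
    rw [le_div_iff₀ (by positivity)]
    have h1 : (1 + x ^ 2) ^ n ≤ 2 ^ (n - 1) * (1 ^ n + (x ^ 2) ^ n) :=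
      add_pow_le zero_le_one (sq_nonneg x) n
    calc f x * (1 + x ^ 2) ^ n ≤ f x * (2 ^ (n - 1) * (1 ^ n + (x ^ 2) ^ n)) := by
          exact mul_le_mul_of_nonneg_left h1 (hpos x).le
      _ = 2 ^ (n - 1) * (f x + x ^ (2 * n) * f x) := by rw [pow_mul]; ring
      _ ≤ A := by
          exact mul_le_mul_of_nonneg_left
            (add_le_add (le_of_abs_le (hfM x)) (le_of_abs_le (hfL x))) (by positivity)
  refine (integrable_inv_one_add_sq.const_mul (A ^ s)).mono'
    (hf.rpow_const fun x => Or.inl (hpos x).ne').aestronglyMeasurable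
    (Eventually.of_forall fun x => ?_)
  rw [Real.norm_of_nonneg (Real.rpow_nonneg (hpos x).le s)]
  calc f x ^ s ≤ (A / (1 + x ^ 2) ^ n) ^ s := Real.rpow_le_rpow (hpos x).le (hbound x) hs.le
    _ = A ^ s * ((1 + x ^ 2) ^ ((n : ℝ) * s))⁻¹ := by
        rw [Real.div_rpow hA.le (by positivity), ← Real.rpow_natCast, ← Real.rpow_mul (by positivity),
          div_eq_mul_inv]
    _ ≤ A ^ s * (1 + x ^ 2)⁻¹ := by
        have : 1 + x ^ 2 ≤ (1 + x ^ 2) ^ ((n : ℝ) * s) :=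
          Real.self_le_rpow_of_one_le (by nlinarith [sq_nonneg x]) hns
        gcongr

theorem sq_deriv_le_of_nonneg {f : ℝ → ℝ} (hf : ContDiff ℝ 2 f) (hnonneg : ∀ x, 0 ≤ f x)
    {M : ℝ} (hM : 0 < M) (hbound : ∀ x, |iteratedDeriv 2 f x| ≤ M) (x : ℝ) :
    deriv f x ^ 2 ≤ 2 * M * f x := by
  have hd : Differentiable ℝ f := hf.differentiable (by norm_num)
  have hd' : Differentiable ℝ (deriv f) := by
    have := hf.differentiable_iteratedDeriv 1 (by norm_num)
    simpa [iteratedDeriv_one] using this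
  have hderiv (y : ℝ) : HasDerivAt (fun y => M / 2 * y ^ 2 - f y) (M * y - deriv f y) y := by
    have h := ((hasDerivAt_pow 2 y).const_mul (M / 2)).sub (hd y).hasDerivAt
    exact h.congr_deriv (by push_cast; ring)
  have hderiv2 (y : ℝ) : HasDerivAt (fun y => M * y - deriv f y) (M - iteratedDeriv 2 f y) y := by
    have h := ((hasDerivAt_id y).const_mul M).sub (hd' y).hasDerivAt
    exact h.congr_deriv (by simp [iteratedDeriv_succ])
  have hmono : Monotone (deriv fun y => M / 2 * y ^ 2 - f y) := by
    have : (deriv fun y => M / 2 * y ^ 2 - f y) = fun y => M * y - deriv f y :=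
      funext fun y => (hderiv y).deriv
    rw [this]
    refine monotone_of_hasDerivAt_nonneg hderiv2 fun y => ?_
    have := le_of_abs_le (hbound y)
    simpa using this
  have hconv : ConvexOn ℝ univ (fun y => M / 2 * y ^ 2 - f y) :=
    hmono.convexOn_univ_of_deriv fun y => (hderiv y).differentiableAt
  set y := x - deriv f x / M with hy
  have hfy := hnonneg y
  have htangent : M / 2 * x ^ 2 - f x + (M * x - deriv f x) * (y - x) ≤ M / 2 * y ^ 2 - f y := by
    rcases lt_trichotomy x y with h | h | h
    · have := hconv.le_slope_of_hasDerivAt (mem_univ x) (mem_univ y) h (hderiv x)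
      rw [slope_def_field, le_div_iff₀ (by linarith)] at this
      linarith
    · rw [← h]; simp
    · have := hconv.slope_le_of_hasDerivAt (mem_univ y) (mem_univ x) h (hderiv x)
      rw [slope_def_field, div_le_iff₀ (by linarith)] at this
      linarith
  have hkey : (M * x - deriv f x) * (y - x) - M / 2 * y ^ 2 + M / 2 * x ^ 2
      = deriv f x ^ 2 / (2 * M) := by
    rw [hy]; field_simp; ring
  have : deriv f x ^ 2 / (2 * M) ≤ f x := by linarith
  rwa [div_le_iff₀ (by positivity), mul_comm] at this

theorem hasDerivAt_rpow_of_pos {f : ℝ → ℝ} (hf : Differentiable ℝ f) (hpos : ∀ x, 0 < f x)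
    (p x : ℝ) : HasDerivAt (fun z => f z ^ p) (deriv f x * p * f x ^ (p - 1)) x :=
  (hf x).hasDerivAt.rpow_const (Or.inl (hpos x).ne')

theorem continuous_fisher_integrand {f : ℝ → ℝ} (hf : ContDiff ℝ 1 f) (hpos : ∀ x, 0 < f x)
    (p : ℝ) : Continuous fun x => deriv (fun z => f z ^ p) x ^ 2 / f x := by
  have hd : deriv (fun z => f z ^ p) = fun x => deriv f x * p * f x ^ (p - 1) :=
    funext fun x => (hasDerivAt_rpow_of_pos (hf.differentiable one_ne_zero) hpos p x).deriv
  rw [hd]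
  have h1 : Continuous (deriv f) := hf.continuous_deriv le_rfl
  have h2 : Continuous fun x => f x ^ (p - 1) :=
    hf.continuous.rpow_const fun x => Or.inl (hpos x).ne'
  exact (((h1.mul continuous_const).mul h2).pow 2).div hf.continuous fun x => (hpos x).ne'

theorem integrable_fisher_integrand {f : ℝ → ℝ} (hf : ContDiff ℝ 2 f) (hpos : ∀ x, 0 < f x)
    {M : ℝ} (hM : 0 < M) (hbound : ∀ x, |iteratedDeriv 2 f x| ≤ M) {p : ℝ}
    (hint : Integrable fun x => f x ^ (2 * (p - 1))) :
    Integrable fun x => deriv (fun z => f z ^ p) x ^ 2 / f x := by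
  refine (hint.const_mul (p ^ 2 * (2 * M))).mono'
    (continuous_fisher_integrand (hf.of_le one_le_two) hpos p).aestronglyMeasurable
    (Eventually.of_forall fun x => ?_)
  have hx := hpos x
  rw [Real.norm_of_nonneg (by positivity), div_le_iff₀ hx,
    (hasDerivAt_rpow_of_pos (hf.differentiable two_ne_zero) hpos p x).deriv]
  have h1 : (f x ^ (p - 1)) ^ 2 = f x ^ (2 * (p - 1)) := by
    rw [← Real.rpow_natCast, ← Real.rpow_mul hx.le]
    push_cast
    rw [mul_comm]
  have h2 := sq_deriv_le_of_nonneg hf (fun x => (hpos x).le) hM hbound x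
  calc (deriv f x * p * f x ^ (p - 1)) ^ 2
      = p ^ 2 * f x ^ (2 * (p - 1)) * deriv f x ^ 2 := by rw [← h1]; ring
    _ ≤ p ^ 2 * f x ^ (2 * (p - 1)) * (2 * M * f x) := by gcongr
    _ = p ^ 2 * (2 * M) * f x ^ (2 * (p - 1)) * f x := by ring

theorem integral_fisher_integrand_pos {f : ℝ → ℝ} (hf : ContDiff ℝ 1 f) (hpos : ∀ x, 0 < f x)
    {p : ℝ} (hN : Integrable fun x => f x ^ p)
    (hI : Integrable fun x => deriv (fun z => f z ^ p) x ^ 2 / f x) :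
    0 < ∫ x, deriv (fun z => f z ^ p) x ^ 2 / f x := by
  have hnonneg (x : ℝ) : 0 ≤ deriv (fun z => f z ^ p) x ^ 2 / f x :=
    div_nonneg (sq_nonneg _) (hpos x).le
  refine (integral_nonneg hnonneg).lt_of_ne' fun h0 => ?_
  have hae := (integral_eq_zero_iff_of_nonneg hnonneg hI).1 h0
  have hzero := ((continuous_fisher_integrand hf hpos p).ae_eq_iff_eq _ continuous_zero).1 hae
  have hderiv (x : ℝ) : deriv (fun z => f z ^ p) x = 0 := by
    have h := congrFun hzero x
    simpa [(hpos x).ne'] using h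
  have hconst : (fun x => f x ^ p) = fun _ => f 0 ^ p := funext fun x =>
    is_const_of_deriv_eq_zero (fun x =>
      (hasDerivAt_rpow_of_pos (hf.differentiable one_ne_zero) hpos p x).differentiableAt) hderiv x 0
  rw [hconst, integrable_const_iff] at hN
  rcases hN with h | h
  · exact (Real.rpow_pos_of_pos (hpos 0) p).ne' h
  · exact absurd h.measure_univ_lt_top (by simp)

theorem rpow_tangent_le {p b c : ℝ} (hp : 1 ≤ p) (hb : 0 < b) (hc : 0 < c) :
    p * c ^ (p - 1) * b ≤ b ^ p + (p - 1) * c ^ p := by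
  have h := one_add_mul_self_le_rpow_one_add (s := b / c - 1) (p := p)
    (by have := div_pos hb hc; linarith) hp
  rw [add_sub_cancel, Real.div_rpow hb.le hc.le, le_div_iff₀ (Real.rpow_pos_of_pos hc p)] at h
  have hcp : c ^ p = c ^ (p - 1) * c := by
    rw [← Real.rpow_add_one hc.ne', sub_add_cancel]
  have hmul : b / c * c ^ p = b * c ^ (p - 1) := by
    rw [hcp]; field_simp
  linarith [congrArg (p * ·) hmul]

theorem transport_entropy_inequality {f B T : ℝ → ℝ} {p a m e : ℝ} (hp : 1 < p)
    (hf : Differentiable ℝ f) (hpos : ∀ x, 0 < f x) (hf0 : Tendsto f (cocompact ℝ) (nhds 0))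
    (hTmem : ∀ x, |T x| ≤ a) (hBT : ∀ x, 0 < B (T x))
    (hTderiv : ∀ x, HasDerivAt T (f x / B (T x)) x)
    (hN : Integrable fun x => f x ^ p)
    (hI : Integrable fun x => deriv (fun z => f z ^ p) x ^ 2 / f x)
    (hmom : Integrable fun x => T x ^ 2 * f x)
    (hent : Integrable fun x => B (T x) ^ (p - 1) * f x) (hm : 0 < m) (he : 0 < e) :
    m ^ (p - 1) * (p * ∫ x, f x ^ p) -
        (p - 1) * m ^ p * (e / 2 * (∫ x, deriv (fun z => f z ^ p) x ^ 2 / f x) +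
          1 / (2 * e) * ∫ x, T x ^ 2 * f x) ≤
      ∫ x, B (T x) ^ (p - 1) * f x := by
  set D := deriv fun z => f z ^ p with hD
  have hfp (x : ℝ) : HasDerivAt (fun z => f z ^ p) (D x) x :=
    (hasDerivAt_rpow_of_pos hf hpos p x).differentiableAt.hasDerivAt
  set c := (p - 1) * m ^ p with hc
  have hcpos : 0 < c := mul_pos (by linarith) (Real.rpow_pos_of_pos hm p)
  set g : ℝ → ℝ := fun x => m ^ (p - 1) * (p * f x ^ p) -
    c * (e / 2 * (D x ^ 2 / f x) + 1 / (2 * e) * (T x ^ 2 * f x)) - B (T x) ^ (p - 1) * f x with hg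
  have hgint : Integrable g :=
    (((hN.const_mul p).const_mul _).sub
      (((hI.const_mul (e / 2)).add (hmom.const_mul (1 / (2 * e)))).const_mul c)).sub hent
  have hgle (x : ℝ) : g x ≤ c * (D x * T x + f x ^ p * (f x / B (T x))) := by
    have hx := hpos x
    have hb := hBT x
    have hyoung : -(D x * T x) ≤ e / 2 * (D x ^ 2 / f x) + 1 / (2 * e) * (T x ^ 2 * f x) := by
      have : e / 2 * (D x ^ 2 / f x) + 1 / (2 * e) * (T x ^ 2 * f x) + D x * T x =
          (e * D x + T x * f x) ^ 2 / (2 * e * f x) := by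
        field_simp; ring
      have : 0 ≤ (e * D x + T x * f x) ^ 2 / (2 * e * f x) := by positivity
      linarith
    have htangent : m ^ (p - 1) * (p * f x ^ p) - B (T x) ^ (p - 1) * f x ≤
        c * (f x ^ p * (f x / B (T x))) := by
      have h := rpow_tangent_le hp.le hb (mul_pos hm hx)
      rw [Real.mul_rpow hm.le hx.le, Real.mul_rpow hm.le hx.le] at h
      have hbp : B (T x) ^ p = B (T x) ^ (p - 1) * B (T x) := by
        rw [← Real.rpow_add_one hb.ne', sub_add_cancel]
      have hfxp : f x ^ p = f x ^ (p - 1) * f x := by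
        rw [← Real.rpow_add_one hx.ne', sub_add_cancel]
      have h' := mul_le_mul_of_nonneg_right h (div_pos hx hb).le
      have e1 : p * (m ^ (p - 1) * f x ^ (p - 1)) * B (T x) * (f x / B (T x)) =
          m ^ (p - 1) * (p * f x ^ p) := by
        rw [hfxp]; field_simp
      have e2 : (B (T x) ^ p + (p - 1) * (m ^ p * f x ^ p)) * (f x / B (T x)) =
          B (T x) ^ (p - 1) * f x + c * (f x ^ p * (f x / B (T x))) := by
        rw [hbp, hc]; field_simp
      linarith
    have := mul_le_mul_of_nonneg_left hyoung hcpos.le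
    simp only [hg]
    linarith
  have hH (x : ℝ) : HasDerivAt (fun z => c * (f z ^ p * T z))
      (c * (D x * T x + f x ^ p * (f x / B (T x)))) x :=
    ((hfp x).mul (hTderiv x)).const_mul c
  have hH0 : Tendsto (fun z => c * (f z ^ p * T z)) (cocompact ℝ) (nhds 0) := by
    have h1 : Tendsto (fun z => c * (f z ^ p * a)) (cocompact ℝ) (nhds 0) := by
      have := ((hf0.rpow_const (Or.inr (by linarith : (0 : ℝ) ≤ p))).mul_const a).const_mul c
      simpa [Real.zero_rpow (by linarith : p ≠ 0)] using this
    refine squeeze_zero_norm (fun z => ?_) h1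
    rw [norm_mul c, norm_mul (f z ^ p), Real.norm_of_nonneg hcpos.le,
      Real.norm_of_nonneg (Real.rpow_nonneg (hpos z).le p), Real.norm_eq_abs]
    have := hTmem z
    have := Real.rpow_nonneg (hpos z).le p
    gcongr
  have htop := hH0.mono_left atTop_le_cocompact
  have hbot := (hH0.mono_left atBot_le_cocompact).comp tendsto_neg_atTop_atBot
  have hlim := intervalIntegral_tendsto_integral hgint tendsto_neg_atTop_atBot tendsto_id
  have hle : ∫ x, g x ≤ 0 - 0 := by
    refine le_of_tendsto_of_tendsto hlim (htop.sub hbot) ?_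
    filter_upwards [eventually_ge_atTop 0] with R hR
    exact intervalIntegral.integral_le_sub_of_hasDeriv_right_of_le (by simpa using hR)
      (fun x _ => (hH x).continuousAt.continuousWithinAt)
      (fun x _ => (hH x).hasDerivWithinAt) hgint.integrableOn (fun x _ => hgle x)
  have hgeq : ∫ x, g x = m ^ (p - 1) * (p * ∫ x, f x ^ p) -
      c * (e / 2 * (∫ x, D x ^ 2 / f x) + 1 / (2 * e) * ∫ x, T x ^ 2 * f x) -
        ∫ x, B (T x) ^ (p - 1) * f x := by
    simp only [hg]
    rw [integral_sub _ hent, integral_sub, integral_const_mul, integral_const_mul,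
      integral_const_mul, integral_add, integral_const_mul, integral_const_mul]
    · exact hI.const_mul _
    · exact hmom.const_mul _
    · exact (hN.const_mul p).const_mul _
    · exact ((hI.const_mul (e / 2)).add (hmom.const_mul (1 / (2 * e)))).const_mul c
    · exact ((hN.const_mul p).const_mul _).sub
        (((hI.const_mul (e / 2)).add (hmom.const_mul (1 / (2 * e)))).const_mul c)
  linarith

section Barenblatt

variable {p C k : ℝ} {B : ℝ → ℝ}

theorem barenblatt_continuous (hp : 1 < p)
    (hB : ∀ y, B y = (max (C - k * y ^ 2) 0) ^ (1 / (p - 1))) : Continuous B := by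
  have hs : 0 ≤ 1 / (p - 1) := div_nonneg zero_le_one (by linarith)
  rw [funext hB]
  exact Continuous.rpow_const (by fun_prop) fun _ => Or.inr hs

theorem barenblatt_nonneg (hB : ∀ y, B y = (max (C - k * y ^ 2) 0) ^ (1 / (p - 1))) (y : ℝ) :
    0 ≤ B y := by
  rw [hB]
  exact Real.rpow_nonneg (le_max_right _ _) _

theorem mem_Ioo_sqrt_iff (hk : 0 < k) (y : ℝ) :
    y ∈ Ioo (-√(C / k)) (√(C / k)) ↔ 0 < C - k * y ^ 2 := by
  rw [mem_Ioo, ← abs_lt, Real.lt_sqrt (abs_nonneg y), sq_abs, lt_div_iff₀ hk, sub_pos, mul_comm]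

theorem barenblatt_pos (hk : 0 < k)
    (hB : ∀ y, B y = (max (C - k * y ^ 2) 0) ^ (1 / (p - 1))) {y : ℝ}
    (hy : y ∈ Ioo (-√(C / k)) (√(C / k))) : 0 < B y := by
  rw [hB]
  exact Real.rpow_pos_of_pos (lt_max_of_lt_left ((mem_Ioo_sqrt_iff hk y).1 hy)) _

theorem barenblatt_eq_zero (hp : 1 < p) (hk : 0 < k)
    (hB : ∀ y, B y = (max (C - k * y ^ 2) 0) ^ (1 / (p - 1))) {y : ℝ}
    (hy : y ∉ Ioo (-√(C / k)) (√(C / k))) : B y = 0 := by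
  rw [mem_Ioo_sqrt_iff hk, not_lt] at hy
  rw [hB, max_eq_right hy, Real.zero_rpow (one_div_pos.2 (by linarith)).ne']

theorem integrable_mul_barenblatt (hp : 1 < p) (hk : 0 < k)
    (hB : ∀ y, B y = (max (C - k * y ^ 2) 0) ^ (1 / (p - 1))) {φ : ℝ → ℝ} (hφ : Continuous φ) :
    Integrable fun y => φ y * B y := by
  refine (hφ.mul (barenblatt_continuous hp hB)).integrable_of_hasCompactSupport
    (HasCompactSupport.intro (isCompact_Icc (a := -√(C / k)) (b := √(C / k))) fun y hy => ?_)
  rw [Pi.mul_apply, barenblatt_eq_zero hp hk hB fun h => hy (Ioo_subset_Icc_self h), mul_zero]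

theorem intervalIntegral_mul_barenblatt (hp : 1 < p) (hk : 0 < k)
    (hB : ∀ y, B y = (max (C - k * y ^ 2) 0) ^ (1 / (p - 1))) (φ : ℝ → ℝ) :
    ∫ y in -√(C / k)..√(C / k), φ y * B y = ∫ y, φ y * B y := by
  refine intervalIntegral.integral_eq_integral_of_support_subset fun y hy => ?_
  by_contra h
  refine hy ?_
  simp only [barenblatt_eq_zero hp hk hB fun h' => h (Ioo_subset_Ioc_self h'), mul_zero]

theorem hasDerivAt_barenblatt_rpow (hp : 1 < p) (hk : 0 < k)
    (hB : ∀ y, B y = (max (C - k * y ^ 2) 0) ^ (1 / (p - 1))) {y : ℝ}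
    (hy : y ∈ Ioo (-√(C / k)) (√(C / k))) :
    HasDerivAt (fun z => B z ^ p) (-(2 * k * p / (p - 1) * (y * B y))) y := by
  have hp1 : p - 1 ≠ 0 := by linarith
  have hy0 := (mem_Ioo_sqrt_iff hk y).1 hy
  have h1 : HasDerivAt (fun z => C - k * z ^ 2) (-(2 * k * y)) y :=
    (((hasDerivAt_pow 2 y).const_mul k).const_sub C).congr_deriv (by push_cast; ring)
  have h2 := h1.rpow_const (p := p / (p - 1)) (Or.inl hy0.ne')
  have heq : (fun z => B z ^ p) =ᶠ[nhds y] fun z => (C - k * z ^ 2) ^ (p / (p - 1)) := by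
    filter_upwards [isOpen_Ioo.mem_nhds hy] with z hz
    have hz0 := (mem_Ioo_sqrt_iff hk z).1 hz
    rw [hB, max_eq_left hz0.le, ← Real.rpow_mul hz0.le]
    congr 1
    field_simp
  refine (h2.congr_of_eventuallyEq heq).congr_deriv ?_
  have hexp : p / (p - 1) - 1 = 1 / (p - 1) := by field_simp; ring
  rw [hexp, hB, max_eq_left hy0.le]
  ring

theorem integral_barenblatt_rpow (hp : 1 < p) (hk : 0 < k)
    (hB : ∀ y, B y = (max (C - k * y ^ 2) 0) ^ (1 / (p - 1))) :
    ∫ y, B y ^ p = 2 * k * p / (p - 1) * ∫ y, y ^ 2 * B y := by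
  set a := √(C / k) with ha
  set K := 2 * k * p / (p - 1) with hK
  have ha0 : 0 ≤ a := Real.sqrt_nonneg _
  have hBc := barenblatt_continuous hp hB
  have hBp : ∀ y, B y ^ p = B y ^ (p - 1) * B y := fun y => by
    rw [← Real.rpow_add_one' (barenblatt_nonneg hB y) (by linarith), sub_add_cancel]
  have hcont : Continuous fun y => B y ^ p := hBc.rpow_const fun _ => Or.inr (by linarith)
  have hcont' : Continuous fun y => K * (y ^ 2 * B y) := by fun_prop
  have hint : ∫ y in -a..a, (B y ^ p - K * (y ^ 2 * B y)) = a * B a ^ p - -a * B (-a) ^ p := by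
    refine intervalIntegral.integral_eq_sub_of_hasDerivAt_of_le (f := fun y => y * B y ^ p)
      (by linarith) (continuous_id.mul hcont).continuousOn (fun y hy => ?_)
      ((hcont.sub hcont').intervalIntegrable _ _)
    exact ((hasDerivAt_id y).mul (hasDerivAt_barenblatt_rpow hp hk hB hy)).congr_deriv
      (by simp only [id, hK]; ring)
  rw [barenblatt_eq_zero hp hk hB (y := a) (by simp [ha]),
    barenblatt_eq_zero hp hk hB (y := -a) (by simp [ha]),
    Real.zero_rpow (by linarith), intervalIntegral.integral_sub (hcont.intervalIntegrable _ _)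
      (hcont'.intervalIntegrable _ _), intervalIntegral.integral_const_mul,
    intervalIntegral_mul_barenblatt hp hk hB] at hint
  simp only [hBp, intervalIntegral_mul_barenblatt hp hk hB, ha] at hint ⊢
  linarith

theorem setIntegral_fisher_barenblatt (hp : 1 < p) (hk : 0 < k)
    (hB : ∀ y, B y = (max (C - k * y ^ 2) 0) ^ (1 / (p - 1))) :
    ∫ y in {y | 0 < B y}, deriv (fun z => B z ^ p) y ^ 2 / B y =
      (2 * k * p / (p - 1)) ^ 2 * ∫ y, y ^ 2 * B y := by
  have hset : {y | 0 < B y} = Ioo (-√(C / k)) (√(C / k)) := by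
    ext y
    refine ⟨fun h => ?_, barenblatt_pos hk hB⟩
    by_contra hy
    exact (ne_of_gt h) (barenblatt_eq_zero hp hk hB hy)
  have hab : -√(C / k) ≤ √(C / k) := by linarith [Real.sqrt_nonneg (C / k)]
  rw [hset, setIntegral_congr_fun (g := fun y => (2 * k * p / (p - 1)) ^ 2 * (y ^ 2 * B y))
    measurableSet_Ioo, integral_const_mul, ← integral_Ioc_eq_integral_Ioo,
    ← intervalIntegral.integral_of_le hab, intervalIntegral_mul_barenblatt hp hk hB]
  intro y hy
  have hb := barenblatt_pos hk hB hy
  simp only [(hasDerivAt_barenblatt_rpow hp hk hB hy).deriv]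
  generalize 2 * k * p / (p - 1) = K
  field_simp

end Barenblatt

theorem exp_log_sub_le_of_rpow_le {p N NB I IB Θ : ℝ} (hp : 1 < p) (hN : 0 < N) (hNB : 0 < NB)
    (hI : 0 < I) (hIB : 0 < IB) (hΘ : 0 < Θ) (hNBsq : NB ^ 2 = Θ * IB)
    (h : N ^ p ≤ NB * √(I * Θ) ^ (p - 1)) :
    Real.exp ((p + 1) * (1 / (1 - p) * Real.log NB - 1 / (1 - p) * Real.log N)) ≤
      (N⁻¹ * I) / (NB⁻¹ * IB) := by
  have hp1 : 0 < p - 1 := by linarith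
  have hS : 0 < √(I * Θ) := Real.sqrt_pos.2 (by positivity)
  rw [← Real.le_log_iff_exp_le (by positivity), Real.log_div (by positivity) (by positivity),
    Real.log_mul (by positivity) hI.ne', Real.log_mul (by positivity) hIB.ne', Real.log_inv,
    Real.log_inv]
  have hlog := Real.log_le_log (Real.rpow_pos_of_pos hN p) h
  rw [Real.log_rpow hN, Real.log_mul hNB.ne' (Real.rpow_pos_of_pos hS _).ne', Real.log_rpow hS,
    Real.log_sqrt (by positivity), Real.log_mul hI.ne' hΘ.ne'] at hlog
  have hsq := congrArg Real.log hNBsq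
  rw [Real.log_pow, Real.log_mul hΘ.ne' hIB.ne'] at hsq
  push_cast at hsq
  have hfrac : (p + 1) * (1 / (1 - p) * Real.log NB - 1 / (1 - p) * Real.log N) =
      (p + 1) * (Real.log N - Real.log NB) / (p - 1) := by
    rw [← neg_sub p 1]; field_simp; ring
  rw [hfrac, div_le_iff₀ hp1]
  have hlogΘ : Real.log Θ = 2 * Real.log NB - Real.log IB := by linarith
  rw [hlogΘ] at hlog
  linarith

/-- the Rényi entropy power inequality
`exp((p+1)(R_p(B) − R_p(f))) ≤ J_p(f)/J_p(B)` relative to the Barenblatt profile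
of the same (unit) mass and second moment. -/
theorem renyi_entropy_power_inequality
    (p : ℝ) (hp : 1 < p)
    (f : ℝ → ℝ) (hsmooth : ContDiff ℝ (⊤ : ℕ∞) f) (hpos : ∀ x, 0 < f x)
    (hdecay : RapidDecay f)
    (hfint : Integrable f) (hfmass : (∫ x : ℝ, f x) = 1)
    (Θ₀ : ℝ) (hΘ₀ : 0 < Θ₀)
    (hfmom_int : Integrable (fun x => x ^ 2 * f x))
    (hfmom : (∫ x : ℝ, x ^ 2 * f x) = Θ₀)
    (C k : ℝ) (hC : 0 < C) (hk : 0 < k)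
    (B : ℝ → ℝ) (hB : ∀ y, B y = (max (C - k * y ^ 2) 0) ^ (1 / (p - 1)))
    (hBmass : (∫ y : ℝ, B y) = 1)
    (hBmom : (∫ y : ℝ, y ^ 2 * B y) = Θ₀) :
    Real.exp ((p + 1) * (renyi p B - renyi p f)) ≤ modFisher p f / modFisher p B := by
  have hp1 : 0 < p - 1 := by linarith
  have hfc : Continuous f := hsmooth.continuous
  have hf2 : ContDiff ℝ 2 f := contDiff_infty.1 hsmooth 2
  have hdecay0 (n : ℕ) : Tendsto (fun x => x ^ n * f x) (cocompact ℝ) (nhds 0) := by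
    simpa using hdecay n 0
  have hf0 : Tendsto f (cocompact ℝ) (nhds 0) := by simpa using hdecay0 0
  obtain ⟨M, hM, hbound⟩ := exists_bound_of_tendsto_cocompact
    (hf2.continuous_iteratedDeriv 2 le_rfl) (by simpa using hdecay 0 2)
  have hN : Integrable fun x => f x ^ p := integrable_rpow_of_decay hfc hpos hdecay0 (by linarith)
  have hI := integrable_fisher_integrand hf2 hpos hM hbound
    (integrable_rpow_of_decay hfc hpos hdecay0 (mul_pos two_pos hp1))
  have hIpos := integral_fisher_integrand_pos (hf2.of_le one_le_two) hpos hN hI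
  have hNpos : 0 < ∫ x, f x ^ p := by
    rw [integral_pos_iff_support_of_nonneg (fun x => Real.rpow_nonneg (hpos x).le p) hN]
    have : Function.support (fun x => f x ^ p) = univ :=
      eq_univ_of_forall fun x => (Real.rpow_pos_of_pos (hpos x) p).ne'
    simp [this]
  have hBc := barenblatt_continuous hp hB
  have hBpos : ∀ y ∈ Ioo (-√(C / k)) (√(C / k)), 0 < B y := fun y => barenblatt_pos hk hB
  have hB0 := barenblatt_nonneg hB
  have ha : 0 < √(C / k) := Real.sqrt_pos.2 (div_pos hC hk)
  obtain ⟨T, hTinj, hTmem, hTderiv⟩ := exists_monotone_transport (by linarith) hfc hpos hfint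
    hfmass hBc hBpos (by
      have := intervalIntegral_mul_barenblatt hp hk hB fun _ => 1
      simpa [hBmass] using this)
  have hTabs (x : ℝ) : |T x| ≤ √(C / k) := (abs_lt.2 (hTmem x)).le
  have hTc : Continuous T := continuous_iff_continuousAt.2 fun x => (hTderiv x).continuousAt
  have hφ : Continuous fun y => B y ^ (p - 1) := hBc.rpow_const fun _ => Or.inr hp1.le
  have hint {φ : ℝ → ℝ} (hφ : Continuous φ) : Integrable fun x => φ (T x) * f x := by
    obtain ⟨L, hL⟩ := (isCompact_Icc (a := -√(C / k)) (b := √(C / k))).exists_bound_of_continuousOn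
      hφ.continuousOn
    exact hfint.bdd_mul (hφ.comp hTc).aestronglyMeasurable
      (Eventually.of_forall fun x => hL _ (Ioo_subset_Icc_self (hTmem x)))
  have hmom_le : ∫ x, T x ^ 2 * f x ≤ Θ₀ := hBmom ▸
    integral_comp_transport_le (φ := fun y => y ^ 2) hTinj hTmem hTderiv hpos hBpos
      (fun y => mul_nonneg (sq_nonneg y) (hB0 y))
      (integrable_mul_barenblatt hp hk hB (by fun_prop))
  have hent_le : ∫ x, B (T x) ^ (p - 1) * f x ≤ ∫ y, B y ^ p := by
    refine (integral_comp_transport_le hTinj hTmem hTderiv hpos hBpos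
      (fun y => mul_nonneg (Real.rpow_nonneg (hB0 y) _) (hB0 y))
      (integrable_mul_barenblatt hp hk hB hφ)).trans_eq ?_
    refine integral_congr_ae (Eventually.of_forall fun y => ?_)
    simp only
    rw [← Real.rpow_add_one' (hB0 y) (by linarith), sub_add_cancel]
  have hNB := integral_barenblatt_rpow hp hk hB
  have hIB := setIntegral_fisher_barenblatt hp hk hB
  rw [hBmom] at hNB hIB
  have hK : 0 < 2 * k * p / (p - 1) := by positivity
  have huniv : {x : ℝ | 0 < f x} = univ := eq_univ_of_forall hpos
  simp only [renyi, modFisher, huniv, Measure.restrict_univ]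
  refine exp_log_sub_le_of_rpow_le hp hNpos (by rw [hNB]; positivity) hIpos
    (by rw [hIB]; positivity) hΘ₀ (by rw [hNB, hIB]; ring) ?_
  set N := ∫ x, f x ^ p
  set I := ∫ x, deriv (fun z => f z ^ p) x ^ 2 / f x
  have hS : 0 < √(I * Θ₀) := Real.sqrt_pos.2 (by positivity)
  have hSsq : √(I * Θ₀) ^ 2 = I * Θ₀ := Real.sq_sqrt (by positivity)
  set S := √(I * Θ₀)
  have hmain := transport_entropy_inequality hp (hf2.differentiable two_ne_zero) hpos hf0 hTabs
    (fun x => hBpos _ (hTmem x)) hTderiv hN hI (hint (φ := fun y => y ^ 2) (by fun_prop))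
    (hint hφ) (div_pos hNpos hS) (div_pos hΘ₀ hS)
  have hcost : Θ₀ / S / 2 * I + 1 / (2 * (Θ₀ / S)) * ∫ x, T x ^ 2 * f x ≤ S := by
    calc _ ≤ Θ₀ / S / 2 * I + 1 / (2 * (Θ₀ / S)) * Θ₀ := by gcongr
      _ = (I * Θ₀) / (2 * S) + S / 2 := by field_simp
      _ = S := by rw [← hSsq]; field_simp; ring
  have hmp : (N / S) ^ p = (N / S) ^ (p - 1) * (N / S) := by
    rw [← Real.rpow_add_one (div_pos hNpos hS).ne', sub_add_cancel]
  have hcoef : 0 ≤ (p - 1) * (N / S) ^ p := by positivity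
  have hcost' := mul_le_mul_of_nonneg_left hcost hcoef
  have hopt : (N / S) ^ (p - 1) * (p * N) - (p - 1) * (N / S) ^ p * S = N ^ p / S ^ (p - 1) := by
    have hNp : N ^ p = N ^ (p - 1) * N := by
      rw [← Real.rpow_add_one hNpos.ne', sub_add_cancel]
    rw [hmp, Real.div_rpow hNpos.le hS.le, hNp]
    field_simp
    ring
  rw [← div_le_iff₀ (Real.rpow_pos_of_pos hS _)]
  linarith
end
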